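/- Let 0 < δ' < δ < 1. Under the blow-up assumptions, the truncated functions ṽ_α := v_α on Ω \ B_{x_α}(r_{α,δ}) and ṽ_α := min(v_α, (1−δ')γ_α) on B_{x_α}(r_{α,δ}) belong to H¹₀(Ω) and satisfy ∫_Ω |∇ṽ_α|² dy ≤ 4π(1 − δ' + o(1)) as α → λ₁⁻. In particular, v_α ⇀ 0 weakly in H¹₀(Ω) and v_α → 0 strongly in L^p(Ω) for every p ≥ 1. -/

import Mathlib

open MeasureTheory intervalIntegral Real Filter Topology Metric Bornology RealInnerProductSpace

noncomputable section

/-- The Euclidean plane `ℝ²`. -/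
abbrev E2 : Type := EuclideanSpace ℝ (Fin 2)

/-- The Laplacian with the paper's sign convention `Δ = −(∂²/∂x² + ∂²/∂y²)`. -/
def lapl (u : E2 → ℝ) (x : E2) : ℝ :=
  -(∑ i : Fin 2, iteratedFDeriv ℝ 2 u x ![EuclideanSpace.single i 1, EuclideanSpace.single i 1])

open Classical in
/-- Truncation of `f` at level `c` inside the set `s`. -/
def truncate (s : Set E2) (f : E2 → ℝ) (c : ℝ) : E2 → ℝ :=
  fun y => if y ∈ s then min (f y) c else f y

theorem volume_add_le_volume_add_real {S T : Set ℝ} (hS : IsOpen S) (hT : IsOpen T)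
    (hS' : S.Nonempty) (hT' : T.Nonempty) {C : Set ℝ} (hC : ∀ s ∈ S, ∀ t ∈ T, s + t ∈ C) :
    volume S + volume T ≤ volume C := by
  obtain ⟨s₀, hs₀⟩ := hS'
  obtain ⟨t₀, ht₀⟩ := hT'
  have key : ∀ K ⊆ S, IsCompact K → ∀ L ⊆ T, IsCompact L → volume K + volume L ≤ volume C := by
    intro K hKS hK L hLT hL
    have hK1 : IsCompact (insert s₀ K) := hK.insert s₀
    have hL1 : IsCompact (insert t₀ L) := hL.insert t₀
    obtain ⟨p, hp⟩ := hK1.exists_isGreatest ⟨s₀, Set.mem_insert _ _⟩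
    obtain ⟨q, hq⟩ := hL1.exists_isLeast ⟨t₀, Set.mem_insert _ _⟩
    have hpS : p ∈ S := (Set.insert_subset hs₀ hKS) hp.1
    have hqT : q ∈ T := (Set.insert_subset ht₀ hLT) hq.1
    have h1 : volume ((fun z => -q + z) ⁻¹' K) = volume K := measure_preimage_add _ _ _
    have h2 : volume ((fun z => -p + z) ⁻¹' L) = volume L := measure_preimage_add _ _ _
    rw [← h1, ← h2, ← measure_union₀']
    · refine measure_mono ?_
      rintro z (hz | hz)
      · simpa using hC _ (hKS hz) _ hqT
      · simpa using hC _ hpS _ (hLT hz)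
    · exact (hK.measurableSet.preimage (by fun_prop)).nullMeasurableSet
    · refine measure_mono_null (t := {p + q}) ?_ (by simp)
      rintro z ⟨hz1, hz2⟩
      have a1 := hp.2 (Set.mem_insert_of_mem _ hz1)
      have a2 := hq.2 (Set.mem_insert_of_mem _ hz2)
      simp only [Set.mem_singleton_iff]
      linarith
  by_contra! h
  obtain ⟨a, ha, b, hb, hab⟩ := ENNReal.exists_lt_add_of_lt_add h
    (hS.measure_pos _ ⟨s₀, hs₀⟩).ne' (hT.measure_pos _ ⟨t₀, ht₀⟩).ne'
  obtain ⟨K, hK, hKc, haK⟩ := hS.exists_lt_isCompact ha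
  obtain ⟨L, hL, hLc, hbL⟩ := hT.exists_lt_isCompact hb
  exact hab.not_ge ((add_le_add haK.le hbL.le).trans (key K hK hKc L hL hLc))

theorem isOpen_setOf_lt_volume_fiber {A : Set (ℝ × ℝ)} (hA : IsOpen A) (t : ENNReal) :
    IsOpen {x : ℝ | t < volume (Prod.mk x ⁻¹' A)} := by
  rw [isOpen_iff_mem_nhds]
  intro x hx
  obtain ⟨K, hK, hKc, hKt⟩ := (hA.preimage (by fun_prop : Continuous (Prod.mk x))).exists_lt_isCompact hx
  obtain ⟨U, W, hU, hW, hxU, hKW, hUW⟩ := generalized_tube_lemma (isCompact_singleton (x := x)) hKc hA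
    (by rintro ⟨y, z⟩ ⟨hy, hz⟩; obtain rfl : y = x := hy; exact hK hz)
  filter_upwards [hU.mem_nhds (hxU rfl)] with y hy
  exact hKt.trans_le (measure_mono fun z hz => hUW ⟨hy, hKW hz⟩)

/-- A planar Brunn–Minkowski inequality for bounded nonempty open sets. -/
theorem brunn_minkowski_prod {A B C : Set (ℝ × ℝ)} (hA : IsOpen A) (hB : IsOpen B)
    (hC : IsOpen C) (hA' : A.Nonempty) (hB' : B.Nonempty)
    (hAb : IsBounded A) (hBb : IsBounded B) (hCb : IsBounded C)
    (hABC : ∀ p ∈ A, ∀ q ∈ B, p + q ∈ C) :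
    volume.real A + volume.real B + 2 * √(volume.real A * volume.real B) ≤ volume.real C := by
  have fib_fin : ∀ {S : Set (ℝ × ℝ)}, IsBounded S → ∃ M : ℝ, 0 ≤ M ∧
      ∀ x, volume (Prod.mk x ⁻¹' S) ≤ ENNReal.ofReal M := by
    intro S hS
    obtain ⟨R, hR⟩ := hS.subset_closedBall 0
    refine ⟨2 * max R 0, by positivity, fun x => ?_⟩
    have : Prod.mk x ⁻¹' S ⊆ Set.Icc (-max R 0) (max R 0) := by
      intro y hy
      have := hR hy
      rw [mem_closedBall_zero_iff, Prod.norm_def] at this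
      have h2 : |y| ≤ R := (le_max_right _ _).trans this
      have := abs_le.1 (h2.trans (le_max_left R 0))
      exact ⟨this.1, this.2⟩
    refine (measure_mono this).trans ?_
    rw [Real.volume_Icc]
    apply ENNReal.ofReal_le_ofReal
    linarith
  have vol_eq : ∀ {S : Set (ℝ × ℝ)}, IsOpen S → IsBounded S →
      ENNReal.ofReal (volume.real S) = ∫⁻ x, ENNReal.ofReal (volume.real (Prod.mk x ⁻¹' S)) := by
    intro S hS hSb
    rw [ofReal_measureReal hSb.measure_lt_top.ne, Measure.volume_eq_prod,
      Measure.prod_apply hS.measurableSet]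
    refine lintegral_congr fun x => ?_
    obtain ⟨M, -, hM⟩ := fib_fin hSb
    rw [ofReal_measureReal ((hM x).trans_lt ENNReal.ofReal_lt_top).ne]
  have fin : ∀ {S : Set (ℝ × ℝ)}, IsBounded S → ∀ x, volume (Prod.mk x ⁻¹' S) ≠ ⊤ := by
    intro S hS x
    obtain ⟨M, -, hM⟩ := fib_fin hS
    exact ((hM x).trans_lt ENNReal.ofReal_lt_top).ne
  have meas : ∀ {S : Set (ℝ × ℝ)}, IsOpen S → Measurable fun x => volume.real (Prod.mk x ⁻¹' S) := by
    intro S hS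
    exact (measurable_measure_prodMk_left hS.measurableSet).ennreal_toReal
  have bdd : ∀ {S : Set (ℝ × ℝ)}, IsBounded S →
      BddAbove (Set.range fun x => volume.real (Prod.mk x ⁻¹' S)) := by
    intro S hS
    obtain ⟨M, hM0, hM⟩ := fib_fin hS
    refine ⟨M, ?_⟩
    rintro _ ⟨x, rfl⟩
    exact ENNReal.toReal_le_of_le_ofReal hM0 (hM x)
  have sup_pos : ∀ {S : Set (ℝ × ℝ)}, IsOpen S → IsBounded S → S.Nonempty →
      0 < ⨆ x, volume.real (Prod.mk x ⁻¹' S) := by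
    rintro S hS hSb ⟨⟨x, y⟩, hxy⟩
    refine lt_of_lt_of_le ?_ (le_ciSup (bdd hSb) x)
    exact ENNReal.toReal_pos ((hS.preimage (by fun_prop : Continuous (Prod.mk x))).measure_pos _
      ⟨y, hxy⟩).ne' (fin hSb x)
  set a := fun x => volume.real (Prod.mk x ⁻¹' A) with ha
  set b := fun x => volume.real (Prod.mk x ⁻¹' B) with hb
  set c := fun x => volume.real (Prod.mk x ⁻¹' C) with hc
  set α := ⨆ x, a x with hα
  set β := ⨆ x, b x with hβ
  have hα0 : 0 < α := sup_pos hA hAb hA'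
  have hβ0 : 0 < β := sup_pos hB hBb hB'
  have scaled : ∀ {S : Set (ℝ × ℝ)} {κ : ℝ}, IsOpen S → IsBounded S → 0 < κ →
      ENNReal.ofReal (volume.real S / κ) =
        ∫⁻ t in Set.Ioi (0 : ℝ), volume {x | t < volume.real (Prod.mk x ⁻¹' S) / κ} := by
    intro S κ hS hSb hκ
    rw [← lintegral_eq_lintegral_meas_lt]
    · simp_rw [div_eq_mul_inv, ENNReal.ofReal_mul measureReal_nonneg]
      rw [lintegral_mul_const _ (meas hS).ennreal_ofReal, vol_eq hS hSb]
    · exact Eventually.of_forall fun x => by positivity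
    · exact ((meas hS).div_const _).aemeasurable
  have openlvl : ∀ {S : Set (ℝ × ℝ)} {κ t : ℝ}, IsOpen S → IsBounded S → 0 < κ → 0 < t →
      IsOpen {x | t < volume.real (Prod.mk x ⁻¹' S) / κ} := by
    intro S κ t hS hSb hκ ht
    convert isOpen_setOf_lt_volume_fiber hS (ENNReal.ofReal (t * κ)) using 3 with x
    rw [lt_div_iff₀ hκ, ENNReal.ofReal_lt_iff_lt_toReal (by positivity) (fin hSb x)]
    rfl
  have main : ENNReal.ofReal (volume.real A / α) + ENNReal.ofReal (volume.real B / β)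
      ≤ ENNReal.ofReal (volume.real C / (α + β)) := by
    rw [scaled hA hAb hα0, scaled hB hBb hβ0, scaled hC hCb (by positivity), ← lintegral_add_left']
    · refine setLIntegral_mono' measurableSet_Ioi fun t ht => ?_
      have ht : 0 < t := ht
      rcases lt_or_ge t 1 with h1 | h1
      · refine volume_add_le_volume_add_real (openlvl hA hAb hα0 ht) (openlvl hB hBb hβ0 ht) ?_ ?_ ?_
        · obtain ⟨x, hx⟩ := exists_lt_of_lt_ciSup (show t * α < ⨆ x, a x by nlinarith)
          exact ⟨x, (lt_div_iff₀ hα0).2 hx⟩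
        · obtain ⟨x, hx⟩ := exists_lt_of_lt_ciSup (show t * β < ⨆ x, b x by nlinarith)
          exact ⟨x, (lt_div_iff₀ hβ0).2 hx⟩
        · intro x hx y hy
          have hx : t < a x / α := hx
          have hy : t < b y / β := hy
          show t < c (x + y) / (α + β)
          rw [lt_div_iff₀ (by positivity)] at *
          have hax : 0 < a x := lt_trans (by positivity) hx
          have hby : 0 < b y := lt_trans (by positivity) hy
          have : a x + b y ≤ c (x + y) := by
            rw [ha, hb, hc]
            simp only [measureReal_def]
            rw [← ENNReal.toReal_add (fin hAb _) (fin hBb _)]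
            refine ENNReal.toReal_mono (fin hCb _) ?_
            refine volume_add_le_volume_add_real (hA.preimage (by fun_prop))
              (hB.preimage (by fun_prop)) ?_ ?_ ?_
            · by_contra h
              rw [Set.not_nonempty_iff_eq_empty] at h
              simp [ha, h] at hax
            · by_contra h
              rw [Set.not_nonempty_iff_eq_empty] at h
              simp [hb, h] at hby
            · intro s hs u hu
              exact hABC _ hs _ hu
          linarith
      · have e1 : {x | t < volume.real (Prod.mk x ⁻¹' A) / α} = ∅ := by
          ext x
          simp only [Set.mem_ofPred_eq, Set.mem_empty_iff_false, iff_false, not_lt]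
          exact ((div_le_one hα0).2 (le_ciSup (bdd hAb) x)).trans h1
        have e2 : {x | t < volume.real (Prod.mk x ⁻¹' B) / β} = ∅ := by
          ext x
          simp only [Set.mem_ofPred_eq, Set.mem_empty_iff_false, iff_false, not_lt]
          exact ((div_le_one hβ0).2 (le_ciSup (bdd hBb) x)).trans h1
        rw [e1, e2]
        simp
    · refine Antitone.measurable (fun s t hst => ?_) |>.aemeasurable
      exact measure_mono fun x (hx : t < _) => lt_of_le_of_lt hst hx
  rw [← ENNReal.ofReal_add (by positivity) (by positivity),
    ENNReal.ofReal_le_ofReal_iff (by positivity), le_div_iff₀ (by positivity)] at main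
  refine le_trans ?_ main
  set X := volume.real A
  set Y := volume.real B
  have hX : 0 ≤ X := measureReal_nonneg
  have hY : 0 ≤ Y := measureReal_nonneg
  have expand : (X / α + Y / β) * (α + β) = X + Y + (X * (β / α) + Y * (α / β)) := by
    field_simp
    ring
  rw [expand]
  have hs : √(X * Y) = √(X * (β / α)) * √(Y * (α / β)) := by
    rw [← Real.sqrt_mul (by positivity)]
    congr 1
    field_simp
  have q1 := Real.sq_sqrt (show 0 ≤ X * (β / α) by positivity)
  have q2 := Real.sq_sqrt (show 0 ≤ Y * (α / β) by positivity)
  nlinarith [sq_nonneg (√(X * (β / α)) - √(Y * (α / β)))]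

/-- The measure-preserving linear identification of `ℝ × ℝ` with the plane. -/
def planeOfProd (p : ℝ × ℝ) : E2 := !₂[p.1, p.2]

theorem continuous_planeOfProd : Continuous planeOfProd := by
  unfold planeOfProd
  fun_prop

theorem planeOfProd_add (p q : ℝ × ℝ) : planeOfProd (p + q) = planeOfProd p + planeOfProd q := by
  ext i
  fin_cases i <;> simp [planeOfProd]

theorem planeOfProd_surjective : Function.Surjective planeOfProd := fun y =>
  ⟨(y 0, y 1), by ext i; fin_cases i <;> simp [planeOfProd]⟩

theorem measurePreserving_planeOfProd : MeasurePreserving planeOfProd := by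
  have h1 := (volume_preserving_finTwoArrow ℝ).symm
  have h2 := PiLp.volume_preserving_toLp (Fin 2)
  have h : planeOfProd = WithLp.toLp 2 ∘ (MeasurableEquiv.finTwoArrow (α := ℝ)).symm := by
    ext p i
    fin_cases i <;> simp [planeOfProd, MeasurableEquiv.finTwoArrow, MeasurableEquiv.piFinTwo]
  rw [h]
  exact h2.comp h1

theorem isBounded_preimage_planeOfProd {S : Set E2} (hS : IsBounded S) :
    IsBounded (planeOfProd ⁻¹' S) := by
  obtain ⟨R, hR⟩ := hS.subset_closedBall 0
  refine (isBounded_closedBall (x := (0 : ℝ × ℝ)) (r := R)).subset fun p hp => ?_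
  have := hR hp
  rw [mem_closedBall_zero_iff] at this ⊢
  rw [Prod.norm_def]
  have h0 := (PiLp.norm_apply_le (planeOfProd p) 0).trans this
  have h1 := (PiLp.norm_apply_le (planeOfProd p) 1).trans this
  exact max_le (by simpa [planeOfProd] using h0) (by simpa [planeOfProd] using h1)

/-- The isoperimetric inequality in Minkowski form, for bounded open planar sets. -/
theorem volume_thickening_ge {K C : Set E2} (hK : IsOpen K) (hKb : IsBounded K)
    (hC : IsOpen C) (hCb : IsBounded C) {ε : ℝ} (hε : 0 < ε)
    (hKC : ∀ p ∈ K, ∀ q, ‖q‖ < ε → p + q ∈ C) :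
    volume.real K + 2 * ε * √(π * volume.real K) ≤ volume.real C := by
  rcases K.eq_empty_or_nonempty with rfl | hne
  · simp
  have hvol : ∀ {S : Set E2}, IsOpen S → volume.real (planeOfProd ⁻¹' S) = volume.real S :=
    fun hS => measurePreserving_planeOfProd.measureReal_preimage hS.measurableSet.nullMeasurableSet
  have ball_vol : volume.real (Metric.ball (0 : E2) ε) = ε ^ 2 * π := by
    rw [measureReal_def, EuclideanSpace.volume_ball_fin_two]
    simp [hε.le, ENNReal.toReal_ofReal, Real.pi_pos.le]
  have := brunn_minkowski_prod (hK.preimage continuous_planeOfProd)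
    ((isOpen_ball (x := (0 : E2)) (ε := ε)).preimage continuous_planeOfProd)
    (hC.preimage continuous_planeOfProd)
    (hne.preimage planeOfProd_surjective)
    ((Metric.nonempty_ball.2 hε).preimage planeOfProd_surjective)
    (isBounded_preimage_planeOfProd hKb) (isBounded_preimage_planeOfProd isBounded_ball)
    (isBounded_preimage_planeOfProd hCb) (by
      intro p hp q hq
      rw [Set.mem_preimage, planeOfProd_add]
      exact hKC _ hp _ (by simpa using hq))
  rw [hvol hK, hvol isOpen_ball, hvol hC, ball_vol] at this
  have e : √(volume.real K * (ε ^ 2 * π)) = ε * √(π * volume.real K) := by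
    rw [show volume.real K * (ε ^ 2 * π) = ε ^ 2 * (π * volume.real K) by ring,
      Real.sqrt_mul (by positivity), Real.sqrt_sq hε.le]
  rw [e] at this
  nlinarith [Real.pi_pos, sq_nonneg ε, mul_nonneg (sq_nonneg ε) Real.pi_pos.le]

theorem le_add_norm_fderiv_of_uniform {u : E2 → ℝ} (hu : ContDiff ℝ 1 u) {ω ρ : ℝ}
    (hρ : ∀ p q : E2, dist p q < ρ → ‖fderiv ℝ u p - fderiv ℝ u q‖ ≤ ω)
    {p q : E2} (hq : ‖q‖ < ρ) :
    u p ≤ u (p + q) + ‖q‖ * (‖fderiv ℝ u (p + q)‖ + ω) := by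
  have hmem : p ∈ Metric.ball (p + q) ρ := by
    rw [Metric.mem_ball, dist_eq_norm, show p - (p + q) = -q by abel, norm_neg]
    exact hq
  have h := (convex_ball (p + q) ρ).norm_image_sub_le_of_norm_fderiv_le' (𝕜 := ℝ) (f := u)
    (φ := fderiv ℝ u (p + q)) (C := ω) (x := p + q) (y := p)
    (fun z _ => (hu.differentiable one_ne_zero) z)
    (fun z hz => hρ _ _ hz) (mem_ball_self ((norm_nonneg q).trans_lt hq))
    hmem
  have e : p - (p + q) = -q := by abel
  rw [e, norm_neg] at h
  have h2 := (fderiv ℝ u (p + q)).le_opNorm (-q)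
  rw [norm_neg] at h2
  have h3 := le_abs_self (u p - u (p + q) - fderiv ℝ u (p + q) (-q))
  have h4 := le_abs_self (fderiv ℝ u (p + q) (-q))
  rw [Real.norm_eq_abs] at h h2
  nlinarith

theorem isoperimetric_strip_aux {u : E2 → ℝ} (hu : ContDiff ℝ 1 u) (hc : HasCompactSupport u)
    {s₀ s₁ s₂ ω : ℝ} (h0 : 0 < s₀) (h01 : s₀ < s₁) (h12 : s₁ < s₂) (hω : 0 < ω) :
    (s₂ - s₁) * (2 * √(π * volume.real {y | s₂ < u y})) ≤
      ∫ y in {y | s₀ < u y ∧ u y ≤ s₂}, (‖fderiv ℝ u y‖ + ω) := by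
  have hdc : Continuous (fderiv ℝ u) := hu.continuous_fderiv one_ne_zero
  have hdcs : HasCompactSupport (fderiv ℝ u) := hc.fderiv ℝ
  have hucont : Continuous u := hu.continuous
  obtain ⟨ρ, hρ0, hρ⟩ := Metric.uniformContinuous_iff.1
    (hdcs.uniformContinuous_of_continuous hdc) ω hω
  obtain ⟨M, hM⟩ := hdcs.exists_bound_of_continuous hdc
  have hM0 : 0 ≤ M := (norm_nonneg _).trans (hM 0)
  obtain ⟨ε, hε0, hερ, hεM⟩ : ∃ ε : ℝ, 0 < ε ∧ ε < ρ ∧ ε * (M + ω) ≤ s₁ - s₀ := by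
    refine ⟨min (ρ / 2) ((s₁ - s₀) / (M + ω)), lt_min (by positivity)
      (div_pos (by linarith) (by positivity)), (min_le_left _ _).trans_lt (by linarith), ?_⟩
    calc _ ≤ (s₁ - s₀) / (M + ω) * (M + ω) := by gcongr; exact min_le_right _ _
      _ = _ := div_mul_cancel₀ _ (by positivity)
  set w : E2 → ℝ := fun y => u y + ε * (‖fderiv ℝ u y‖ + ω) with hw
  have hwc : Continuous w := by fun_prop
  have huw : ∀ y, u y ≤ w y := fun y => by
    have : 0 ≤ ε * (‖fderiv ℝ u y‖ + ω) := by positivity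
    simp only [hw]; linarith
  have hwu : ∀ y, w y ≤ u y + (s₁ - s₀) := fun y => by
    have : ε * (‖fderiv ℝ u y‖ + ω) ≤ ε * (M + ω) := by gcongr; exact hM y
    simp only [hw]; linarith
  have bdd : ∀ s, 0 < s → IsBounded {y | s < u y} := fun s hs =>
    hc.isCompact.isBounded.subset fun y (hy : s < u y) =>
      subset_tsupport _ (by simpa using (hs.trans hy).ne')
  have bddw : ∀ s, s₁ ≤ s → IsBounded {y | s < w y} := fun s hs =>
    (bdd s₀ h0).subset fun y (hy : s < w y) => show s₀ < u y by linarith [hwu y]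
  have iso : ∀ s, s₁ ≤ s → volume.real {y | s < u y} + 2 * ε * √(π * volume.real {y | s < u y})
      ≤ volume.real {y | s < w y} := by
    intro s hs
    refine volume_thickening_ge (isOpen_lt continuous_const hucont) (bdd s (by linarith))
      (isOpen_lt continuous_const hwc) (bddw s hs) hε0 ?_
    intro p hp q hq
    have hp : s < u p := hp
    have := le_add_norm_fderiv_of_uniform hu (fun a b hab => by
      simpa [dist_eq_norm] using (hρ hab).le) (hq.trans hερ) (p := p)
    have h2 : ‖q‖ * (‖fderiv ℝ u (p + q)‖ + ω) ≤ ε * (‖fderiv ℝ u (p + q)‖ + ω) := by gcongr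
    show s < w (p + q)
    simp only [hw]
    linarith
  set T : (E2 → ℝ) → E2 → ℝ := fun f y => min (max (f y - s₁) 0) (s₂ - s₁) with hT
  have hTnn : ∀ f y, 0 ≤ T f y := fun f y => le_min (le_max_right _ _) (by linarith)
  have hTc : ∀ f, Continuous f → Continuous (T f) := fun f hf => by simp only [hT]; fun_prop
  have hTint : ∀ f, Continuous f → (∀ y, f y ≤ w y) → Integrable (T f) := by
    intro f hf hfw
    refine (hTc f hf).integrable_of_hasCompactSupport (hc.mono fun y hy => ?_)
    rw [Function.mem_support] at hy ⊢
    intro hy0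
    apply hy
    have : f y - s₁ ≤ 0 := by linarith [hfw y, hwu y]
    simp only [hT]
    rw [max_eq_right this, min_eq_left (by linarith)]
  have hTlvl : ∀ f, ∀ t > 0, {y | t < T f y} = if t < s₂ - s₁ then {y | s₁ + t < f y} else ∅ := by
    intro f t ht
    split_ifs with h
    · ext y
      simp only [hT, Set.mem_ofPred_eq, lt_min_iff, lt_max_iff, h, and_true, ht.not_gt, or_false]
      constructor <;> intro h <;> linarith
    · ext y
      simp only [hT, Set.mem_ofPred_eq, lt_min_iff, h, and_false, Set.mem_empty_iff_false]
  set c := 2 * ε * √(π * volume.real {y | s₂ < u y}) with hcdef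
  have hc0 : 0 ≤ c := by positivity
  have layer : (∫⁻ y, ENNReal.ofReal (T u y)) + ENNReal.ofReal ((s₂ - s₁) * c)
      ≤ ∫⁻ y, ENNReal.ofReal (T w y) := by
    have e1 : ENNReal.ofReal ((s₂ - s₁) * c) =
        ∫⁻ t in Set.Ioi (0 : ℝ), (Set.Ioo 0 (s₂ - s₁)).indicator (fun _ => ENNReal.ofReal c) t := by
      rw [lintegral_indicator measurableSet_Ioo, Measure.restrict_restrict measurableSet_Ioo,
        Set.inter_eq_self_of_subset_left Set.Ioo_subset_Ioi_self, setLIntegral_const,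
        Real.volume_Ioo, sub_zero, mul_comm, ENNReal.ofReal_mul hc0]
    rw [lintegral_eq_lintegral_meas_lt _ (Eventually.of_forall (hTnn u))
      (hTc u hucont).aemeasurable, lintegral_eq_lintegral_meas_lt _ (Eventually.of_forall (hTnn w))
      (hTc w hwc).aemeasurable, e1, ← lintegral_add_right _
        (measurable_const.indicator measurableSet_Ioo)]
    refine setLIntegral_mono' measurableSet_Ioi fun t ht => ?_
    have ht : 0 < t := ht
    rw [hTlvl u t ht, hTlvl w t ht]
    split_ifs with h
    · rw [Set.indicator_of_mem (show t ∈ Set.Ioo 0 (s₂ - s₁) from ⟨ht, h⟩)]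
      rw [← ofReal_measureReal (bdd _ (by linarith)).measure_lt_top.ne,
        ← ofReal_measureReal (bddw _ (by linarith)).measure_lt_top.ne,
        ← ENNReal.ofReal_add measureReal_nonneg hc0]
      apply ENNReal.ofReal_le_ofReal
      refine le_trans ?_ (iso (s₁ + t) (by linarith))
      have : volume.real {y | s₂ < u y} ≤ volume.real {y | s₁ + t < u y} :=
        measureReal_mono (fun y (hy : s₂ < u y) => show s₁ + t < u y by linarith)
          (bdd _ (by linarith)).measure_lt_top.ne
      rw [hcdef]
      gcongr
    · rw [Set.indicator_of_notMem (fun h' => h h'.2)]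
      simp
  rw [← ofReal_integral_eq_lintegral_ofReal (hTint u hucont huw) (Eventually.of_forall (hTnn u)),
    ← ofReal_integral_eq_lintegral_ofReal (hTint w hwc fun _ => le_rfl)
      (Eventually.of_forall (hTnn w)),
    ← ENNReal.ofReal_add (integral_nonneg (hTnn u)) (mul_nonneg (by linarith) hc0),
    ENNReal.ofReal_le_ofReal_iff (integral_nonneg (hTnn w))] at layer
  set S := {y | s₀ < u y ∧ u y ≤ s₂} with hS
  have hSm : MeasurableSet S :=
    (measurableSet_lt measurable_const hucont.measurable).inter
      (measurableSet_le hucont.measurable measurable_const)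
  have hSfin : volume S < ⊤ := ((bdd s₀ h0).subset fun y hy => hy.1).measure_lt_top
  have hint : IntegrableOn (fun y => ε * (‖fderiv ℝ u y‖ + ω)) S := by
    refine Integrable.const_mul (Integrable.add ?_ ?_) _
    · exact ((hdc.norm).integrable_of_hasCompactSupport hdcs.norm).integrableOn
    · exact integrableOn_const hSfin.ne
  have diff : (∫ y, T w y) - ∫ y, T u y ≤ ∫ y in S, ε * (‖fderiv ℝ u y‖ + ω) := by
    rw [← integral_sub (hTint w hwc fun _ => le_rfl) (hTint u hucont huw),
      ← MeasureTheory.integral_indicator hSm]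
    refine integral_mono ((hTint w hwc fun _ => le_rfl).sub (hTint u hucont huw))
      ((integrable_indicator_iff hSm).2 hint) fun y => ?_
    by_cases hy : y ∈ S
    · rw [Set.indicator_of_mem hy]
      have hwy : w y = u y + ε * (‖fderiv ℝ u y‖ + ω) := rfl
      have := huw y
      simp only [hT]
      rcases max_cases (w y - s₁) 0 with ⟨e1, h1⟩ | ⟨e1, h1⟩ <;>
      rcases max_cases (u y - s₁) 0 with ⟨e2, h2⟩ | ⟨e2, h2⟩ <;>
      rw [e1, e2] <;>
      rcases min_cases (w y - s₁) (s₂ - s₁) with ⟨e3, h3⟩ | ⟨e3, h3⟩ <;>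
      rcases min_cases (u y - s₁) (s₂ - s₁) with ⟨e4, h4⟩ | ⟨e4, h4⟩ <;>
      rcases min_cases 0 (s₂ - s₁) with ⟨e5, h5⟩ | ⟨e5, h5⟩ <;>
      linarith
    · rw [Set.indicator_of_notMem hy]
      have : u y ≤ s₀ ∨ s₂ < u y := by
        by_contra! h
        exact hy ⟨h.1, h.2⟩
      simp only [hT]
      rcases this with h | h
      · rw [max_eq_right (show w y - s₁ ≤ 0 by linarith [hwu y]), max_eq_right
          (show u y - s₁ ≤ 0 by linarith), sub_self]
      · have := huw y
        rw [min_eq_right (show s₂ - s₁ ≤ max (w y - s₁) 0 from le_max_of_le_left (by linarith)),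
          min_eq_right (show s₂ - s₁ ≤ max (u y - s₁) 0 from le_max_of_le_left (by linarith)),
          sub_self]
  rw [MeasureTheory.integral_const_mul] at diff
  have : ε * ((s₂ - s₁) * (2 * √(π * volume.real {y | s₂ < u y}))) ≤
      ε * ∫ y in S, (‖fderiv ℝ u y‖ + ω) := by
    calc _ = (s₂ - s₁) * c := by rw [hcdef]; ring
      _ ≤ _ := by linarith
  exact le_of_mul_le_mul_left this hε0

/-- The isoperimetric inequality, integrated over the levels between `s₁` and `s₂`. -/
theorem isoperimetric_strip {u : E2 → ℝ} (hu : ContDiff ℝ 1 u) (hc : HasCompactSupport u)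
    {s₁ s₂ : ℝ} (h0 : 0 < s₁) (h12 : s₁ < s₂) :
    (s₂ - s₁) * (2 * √(π * volume.real {y | s₂ < u y})) ≤
      ∫ y in {y | s₁ < u y ∧ u y ≤ s₂}, ‖fderiv ℝ u y‖ := by
  set S := {y | s₁ < u y ∧ u y ≤ s₂} with hS
  have hSfin : volume S < ⊤ := by
    refine (hc.isCompact.isBounded.subset fun y (hy : y ∈ S) => subset_tsupport _ ?_).measure_lt_top
    simpa using (h0.trans hy.1).ne'
  have hint : IntegrableOn (fun y => ‖fderiv ℝ u y‖) S :=
    (((hu.continuous_fderiv one_ne_zero).norm).integrable_of_hasCompactSupport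
      (hc.fderiv ℝ).norm).integrableOn
  have key : ∀ τ > 0, s₁ + τ < s₂ → (s₂ - (s₁ + τ)) * (2 * √(π * volume.real {y | s₂ < u y})) ≤
      (∫ y in S, ‖fderiv ℝ u y‖) + τ * volume.real S := by
    intro τ hτ hτ2
    have := isoperimetric_strip_aux hu hc h0 (show s₁ < s₁ + τ by linarith) hτ2 hτ
    rw [integral_add hint (integrableOn_const hSfin.ne), setIntegral_const, smul_eq_mul] at this
    rw [mul_comm τ]
    exact this
  refine le_of_tendsto_of_tendsto (f := fun τ : ℝ =>
    (s₂ - (s₁ + τ)) * (2 * √(π * volume.real {y | s₂ < u y})))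
    (g := fun τ : ℝ => (∫ y in S, ‖fderiv ℝ u y‖) + τ * volume.real S)
    (b := 𝓝[>] 0) ?_ ?_ ?_
  · have : Continuous fun τ : ℝ => (s₂ - (s₁ + τ)) * (2 * √(π * volume.real {y | s₂ < u y})) := by
      fun_prop
    simpa using (this.tendsto 0).mono_left nhdsWithin_le_nhds
  · have : Continuous fun τ : ℝ => (∫ y in S, ‖fderiv ℝ u y‖) + τ * volume.real S := by fun_prop
    simpa using (this.tendsto 0).mono_left nhdsWithin_le_nhds
  · have : Set.Ioo (0 : ℝ) (s₂ - s₁) ∈ 𝓝[>] (0 : ℝ) := Ioo_mem_nhdsGT (by linarith)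
    filter_upwards [this] with τ hτ
    exact key τ hτ.1 (by linarith [hτ.2])

/-- A function whose increments are bounded by the length of the interval times the decrement
of some function `Q` does not increase. -/
theorem le_of_forall_le_add_mul_sub {h Q : ℝ → ℝ} {a b : ℝ} (hab : a ≤ b)
    (H : ∀ s₁ s₂, a ≤ s₁ → s₁ ≤ s₂ → s₂ ≤ b → h s₂ ≤ h s₁ + (s₂ - s₁) * (Q s₁ - Q s₂)) :
    h b ≤ h a := by
  have key : ∀ N : ℕ, h b ≤ h a + (b - a) / (N + 1 : ℝ) * (Q a - Q b) := by
    intro N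
    have hN : (0 : ℝ) < N + 1 := by positivity
    set η : ℝ := (b - a) / (N + 1 : ℝ) with hη
    have hη0 : 0 ≤ η := div_nonneg (by linarith) hN.le
    have hηN : η * (N + 1 : ℝ) = b - a := by rw [hη]; field_simp
    have ind : ∀ k : ℕ, k ≤ N + 1 → h (a + k * η) ≤ h a + η * (Q a - Q (a + k * η)) := by
      intro k
      induction k with
      | zero => intro _; simp
      | succ k ih =>
        intro hk
        have h1 := ih (by omega)
        have hk' : ((k : ℝ) + 1) ≤ N + 1 := by exact_mod_cast hk
        have h2 := H (a + k * η) (a + ((k + 1 : ℕ) : ℝ) * η) (by nlinarith [(k.cast_nonneg : (0 : ℝ) ≤ k)])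
          (by push_cast; linarith) (by push_cast; nlinarith)
        have h3 : a + ((k + 1 : ℕ) : ℝ) * η - (a + k * η) = η := by push_cast; ring
        rw [h3] at h2
        linarith
    have h4 := ind (N + 1) le_rfl
    have h5 : a + ((N + 1 : ℕ) : ℝ) * η = b := by push_cast; linarith
    rwa [h5] at h4
  have hlim : Tendsto (fun N : ℕ => h a + (b - a) / (N + 1 : ℝ) * (Q a - Q b)) atTop
      (𝓝 (h a + 0 * (Q a - Q b))) := by
    refine tendsto_const_nhds.add (Tendsto.mul_const _ ?_)
    have := (tendsto_one_div_add_atTop_nhds_zero_nat (𝕜 := ℝ)).const_mul (b - a)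
    simpa [div_eq_mul_inv] using this
  have := ge_of_tendsto' hlim key
  simpa using this

/-- The distribution functions of a superlevel foliation: `m` is the measure, `F` the mass of the
density `G`, and the last two fields are the isoperimetric inequality and the growth bound
for `G`. -/
structure IsBolProfile (m F G : ℝ → ℝ) (κ s₀ γ : ℝ) : Prop where
  kappa_pos : 0 < κ
  nonneg : 0 ≤ s₀
  antitone : ∀ s₁ s₂, s₀ ≤ s₁ → s₁ ≤ s₂ → s₂ ≤ γ → m s₂ ≤ m s₁
  m_top : m γ = 0
  F_top : F γ = 0
  G_pos : ∀ s, s₀ ≤ s → s ≤ γ → 0 < G s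
  le_sub : ∀ s₁ s₂, s₀ ≤ s₁ → s₁ ≤ s₂ → s₂ ≤ γ → G s₁ * (m s₁ - m s₂) ≤ F s₁ - F s₂
  sub_le : ∀ s₁ s₂, s₀ ≤ s₁ → s₁ ≤ s₂ → s₂ ≤ γ → F s₁ - F s₂ ≤ G s₂ * (m s₁ - m s₂)
  isop : ∀ s₁ s₂, s₀ ≤ s₁ → s₁ ≤ s₂ → s₂ ≤ γ →
    4 * π * m s₂ * (s₂ - s₁) ≤ F s₁ * (m s₁ - m s₂)
  growth : ∀ s₁ s₂, s₀ ≤ s₁ → s₁ ≤ s₂ → s₂ ≤ γ → G s₂ ≤ G s₁ * exp (2 * κ * (s₂ - s₁))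

namespace IsBolProfile

variable {m F G : ℝ → ℝ} {κ s₀ γ : ℝ}

theorem F_antitone (P : IsBolProfile m F G κ s₀ γ) {s₁ s₂ : ℝ} (h0 : s₀ ≤ s₁) (h12 : s₁ ≤ s₂)
    (h2 : s₂ ≤ γ) : F s₂ ≤ F s₁ := by
  have h3 := P.le_sub s₁ s₂ h0 h12 h2
  have h4 := P.antitone s₁ s₂ h0 h12 h2
  have h5 := P.G_pos s₁ h0 (h12.trans h2)
  nlinarith [mul_nonneg h5.le (sub_nonneg.2 h4)]

theorem F_nonneg (P : IsBolProfile m F G κ s₀ γ) {s : ℝ} (h0 : s₀ ≤ s) (h2 : s ≤ γ) :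
    0 ≤ F s := by
  simpa [P.F_top] using P.F_antitone h0 h2 le_rfl

theorem m_nonneg (P : IsBolProfile m F G κ s₀ γ) {s : ℝ} (h0 : s₀ ≤ s) (h2 : s ≤ γ) :
    0 ≤ m s := by
  simpa [P.m_top] using P.antitone s γ h0 h2 le_rfl

theorem mul_le_F (P : IsBolProfile m F G κ s₀ γ) {s : ℝ} (h0 : s₀ ≤ s) (h2 : s ≤ γ) :
    G s * m s ≤ F s := by
  simpa [P.m_top, P.F_top] using P.le_sub s γ h0 h2 le_rfl

theorem G_mono (P : IsBolProfile m F G κ s₀ γ) {s₁ s₂ : ℝ} (h0 : s₀ ≤ s₁) (h12 : s₁ ≤ s₂)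
    (h2 : s₂ ≤ γ) : G s₁ * (m s₁ - m s₂) ≤ G s₂ * (m s₁ - m s₂) :=
  (P.le_sub s₁ s₂ h0 h12 h2).trans (P.sub_le s₁ s₂ h0 h12 h2)

set_option maxHeartbeats 1000000 in
/-- Bol's inequality. -/
theorem bol (P : IsBolProfile m F G κ s₀ γ) {s : ℝ} (h0 : s₀ ≤ s) (hs : s ≤ γ) :
    F s * (4 * π - κ * F s) ≤ 4 * π * (m s * G s) := by
  have hκ := P.kappa_pos
  have hc : (0 : ℝ) < 4 * π := by positivity
  set c : ℝ := 4 * π with hcdef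
  set Gc : ℝ := exp (2 * κ * (γ - s)) with hGc
  have hGc1 : 0 < Gc := exp_pos _
  set C : ℝ := 2 * κ + 4 * κ ^ 2 * (γ - s) * Gc + κ with hC
  set C' : ℝ := F s * (4 * κ ^ 2 * Gc) with hC'
  have key := le_of_forall_le_add_mul_sub (h := fun t => m t * G t - F t + κ / c * F t ^ 2)
    (Q := fun t => C * F t - C' * t) hs ?_
  · simp only [P.m_top, P.F_top] at key
    have h1 : 0 ≤ m s * G s - F s + κ / c * F s ^ 2 := by linarith
    have h2 : c * (m s * G s - F s + κ / c * F s ^ 2) =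
        c * (m s * G s) - F s * (c - κ * F s) := by field_simp; ring
    have := mul_nonneg hc.le h1
    linarith
  intro s₁ s₂ h1 h12 h2
  have h01 := h0.trans h1
  have hF2 := P.F_nonneg (h01.trans h12) h2
  have hF12 := P.F_antitone h01 h12 h2
  have hFs := P.F_antitone h0 h1 (h12.trans h2)
  have hm2 := P.m_nonneg (h01.trans h12) h2
  have hm12 := P.antitone _ _ h01 h12 h2
  have hG1 := P.G_pos _ h01 (h12.trans h2)
  have hle := P.le_sub _ _ h01 h12 h2
  have hsub := P.sub_le _ _ h01 h12 h2
  have his := P.isop _ _ h01 h12 h2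
  rw [← hcdef] at his
  have hgr := P.growth _ _ h01 h12 h2
  have hGm := P.mul_le_F (h01.trans h12) h2
  have hgm := P.G_mono h01 h12 h2
  have hmF1 := P.mul_le_F h01 (h12.trans h2)
  set η := s₂ - s₁ with hη
  have hη0 : 0 ≤ η := sub_nonneg.2 h12
  have hηle : η ≤ γ - s := by rw [hη]; linarith
  set d := m s₁ - m s₂ with hd
  have hd0 : 0 ≤ d := sub_nonneg.2 hm12
  set Δ := F s₁ - F s₂ with hΔ
  have hΔ0 : 0 ≤ Δ := sub_nonneg.2 hF12
  have hG1F2 : G s₁ * m s₂ ≤ F s₂ := by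
    rcases hd0.eq_or_lt with hd' | hd'
    · have e1 : m s₁ = m s₂ := by linarith
      have e2 : F s₁ - F s₂ = 0 := by
        rw [← hd'] at hle hsub
        simp only [mul_zero] at hle hsub
        linarith
      rw [e1] at hmF1
      linarith
    · have := le_of_mul_le_mul_right hgm hd'
      exact (mul_le_mul_of_nonneg_right this hm2).trans hGm
  have hexp : exp (2 * κ * η) ≤ 1 + 2 * κ * η + 4 * κ ^ 2 * η ^ 2 * Gc := by
    have e0 : 0 ≤ 2 * κ * η := by positivity
    have e1 : exp (2 * κ * η) ≤ Gc := exp_le_exp.2 (by gcongr)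
    have e2 : exp (2 * κ * η) - 1 ≤ 2 * κ * η * exp (2 * κ * η) := by
      have := add_one_le_exp (-(2 * κ * η))
      have h3 : exp (-(2 * κ * η)) * exp (2 * κ * η) = 1 := by rw [← exp_add]; simp
      nlinarith [exp_pos (2 * κ * η)]
    nlinarith [mul_le_mul_of_nonneg_left e1 (mul_nonneg e0 e0),
      mul_le_mul_of_nonneg_left e2 e0]
  have hX1 : c * (G s₁ * m s₂) * η ≤ Δ * F s₁ := by
    calc c * (G s₁ * m s₂) * η = G s₁ * (c * m s₂ * η) := by ring
      _ ≤ G s₁ * (F s₁ * d) := by gcongr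
      _ = (G s₁ * d) * F s₁ := by ring
      _ ≤ Δ * F s₁ := mul_le_mul_of_nonneg_right hle (hF2.trans hF12)
  have hX : 2 * (c * (G s₁ * m s₂) * η) - c * η * Δ ≤ Δ * (F s₁ + F s₂) := by
    rcases le_total (c * η) Δ with h | h
    · have e1 : c * (G s₁ * m s₂) * η ≤ c * η * F s₂ := by
        calc c * (G s₁ * m s₂) * η = c * η * (G s₁ * m s₂) := by ring
          _ ≤ _ := by gcongr
      have e2 : c * η * F s₂ ≤ Δ * F s₂ := mul_le_mul_of_nonneg_right h hF2
      have e3 : 0 ≤ c * η * Δ := by positivity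
      rw [mul_add]
      linarith
    · have e2 : Δ * Δ ≤ c * η * Δ := mul_le_mul_of_nonneg_right h hΔ0
      have e3 : F s₂ = F s₁ - Δ := by rw [hΔ]; ring
      have e4 : Δ * (F s₁ + F s₂) = 2 * (Δ * F s₁) - Δ * Δ := by rw [e3]; ring
      linarith
  have hXκ : 2 * κ * (G s₁ * m s₂) * η - κ * η * Δ ≤ κ / c * (Δ * (F s₁ + F s₂)) := by
    have := mul_le_mul_of_nonneg_left hX (div_pos hκ hc).le
    have e : κ / c * (2 * (c * (G s₁ * m s₂) * η) - c * η * Δ) =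
        2 * κ * (G s₁ * m s₂) * η - κ * η * Δ := by field_simp
    linarith
  have hGG : G s₂ - G s₁ ≤ G s₁ * (2 * κ * η + 4 * κ ^ 2 * η ^ 2 * Gc) := by
    have := mul_le_mul_of_nonneg_left hexp hG1.le
    linarith
  have t1 : m s₂ * (G s₂ - G s₁) ≤ 2 * κ * (G s₁ * m s₂) * η + C' * η ^ 2 := by
    calc m s₂ * (G s₂ - G s₁) ≤ m s₂ * (G s₁ * (2 * κ * η + 4 * κ ^ 2 * η ^ 2 * Gc)) := by gcongr
      _ = 2 * κ * (G s₁ * m s₂) * η + (G s₁ * m s₂) * (4 * κ ^ 2 * Gc) * η ^ 2 := by ring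
      _ ≤ 2 * κ * (G s₁ * m s₂) * η + F s * (4 * κ ^ 2 * Gc) * η ^ 2 := by
        gcongr
        linarith
  have t2 : Δ - G s₁ * d ≤ (2 * κ + 4 * κ ^ 2 * (γ - s) * Gc) * η * Δ := by
    calc Δ - G s₁ * d ≤ (G s₂ - G s₁) * d := by linarith
      _ ≤ (G s₁ * (2 * κ * η + 4 * κ ^ 2 * η ^ 2 * Gc)) * d := by gcongr
      _ = (2 * κ + 4 * κ ^ 2 * η * Gc) * η * (G s₁ * d) := by ring
      _ ≤ (2 * κ + 4 * κ ^ 2 * (γ - s) * Gc) * η * Δ := by gcongr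
  have e1 : m s₂ * G s₂ - F s₂ + κ / c * F s₂ ^ 2 - (m s₁ * G s₁ - F s₁ + κ / c * F s₁ ^ 2) =
      m s₂ * (G s₂ - G s₁) + (Δ - G s₁ * d) - κ / c * (Δ * (F s₁ + F s₂)) := by
    rw [hΔ, hd]; ring
  have e2 : η * (C * F s₁ - C' * s₁ - (C * F s₂ - C' * s₂)) = C * η * Δ + C' * η ^ 2 := by
    rw [hΔ, hη]; ring
  have e3 : C * η * Δ = (2 * κ + 4 * κ ^ 2 * (γ - s) * Gc) * η * Δ + κ * η * Δ := by
    rw [hC]; ring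
  linarith

set_option maxHeartbeats 1000000 in
/-- The lower bound for the mass obtained by integrating Bol's inequality. -/
theorem le_F (P : IsBolProfile m F G κ s₀ γ) {s b : ℝ} (h0 : s₀ ≤ s) (hs : s ≤ b)
    (hb : b ≤ γ) (hF : 0 < F b) :
    4 * π * (1 - exp (-(κ * (b - s)))) ≤ κ * F s := by
  have hκ := P.kappa_pos
  have hc : (0 : ℝ) < 4 * π := by positivity
  set c : ℝ := 4 * π with hcdef
  have key := le_of_forall_le_add_mul_sub (h := fun t => -(exp (-(κ * t)) * (c - κ * F t)))
    (Q := fun t => c * κ * (F t / F b - 2 * κ * t)) hs ?_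
  · have h1 : exp (-(κ * s)) * (c - κ * F s) ≤ exp (-(κ * b)) * c := by
      have : exp (-(κ * b)) * (c - κ * F b) ≤ exp (-(κ * b)) * c := by
        gcongr
        nlinarith
      linarith
    have h2 : exp (κ * s) * exp (-(κ * s)) = 1 := by rw [← exp_add]; simp
    have h3 : exp (κ * s) * exp (-(κ * b)) = exp (-(κ * (b - s))) := by
      rw [← exp_add]; congr 1; ring
    have h4 := mul_le_mul_of_nonneg_left h1 (exp_pos (κ * s)).le
    rw [← mul_assoc, ← mul_assoc, h2, h3] at h4
    linarith
  intro s₁ s₂ h1 h12 h2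
  have h01 := h0.trans h1
  have h2γ := h2.trans hb
  have hF2b := P.F_antitone (h01.trans h12) h2 hb
  have hF12 := P.F_antitone h01 h12 h2γ
  have hm2 := P.m_nonneg (h01.trans h12) h2γ
  have hm12 := P.antitone _ _ h01 h12 h2γ
  have hG1 := P.G_pos _ h01 (h12.trans h2γ)
  have hle := P.le_sub _ _ h01 h12 h2γ
  have his := P.isop _ _ h01 h12 h2γ
  rw [← hcdef] at his
  have hgr := P.growth _ _ h01 h12 h2γ
  have hbol := P.bol (h01.trans h12) h2γ
  rw [← hcdef] at hbol
  have hs1 : 0 ≤ s₁ := P.nonneg.trans h01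
  have hF1 : 0 < F s₁ := by linarith
  have hF2 : 0 < F s₂ := by linarith
  set η := s₂ - s₁ with hη
  have hη0 : 0 ≤ η := sub_nonneg.2 h12
  set Δ := F s₁ - F s₂ with hΔ
  have hΔ0 : 0 ≤ Δ := sub_nonneg.2 hF12
  set err : ℝ := 2 * κ * η + Δ / F b with herr
  have herr0 : 0 ≤ err := by positivity
  have e2 : η * (c * κ * (F s₁ / F b - 2 * κ * s₁) - c * κ * (F s₂ / F b - 2 * κ * s₂)) =
      c * κ * η * err := by
    rw [herr, hΔ, hη]; ring
  rw [e2]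
  suffices exp (-(κ * s₁)) * (c - κ * F s₁) ≤ exp (-(κ * s₂)) * (c - κ * F s₂) + c * κ * η * err by
    linarith
  have hk12 : c - κ * F s₁ = c - κ * F s₂ - κ * Δ := by rw [hΔ]; ring
  set k₂ := c - κ * F s₂ with hk₂
  have hk2c : k₂ ≤ c := by rw [hk₂]; nlinarith
  have hes : exp (-(κ * s₂)) ≤ exp (-(κ * s₁)) := exp_le_exp.2 (by nlinarith)
  have hes1 : exp (-(κ * s₁)) ≤ 1 := exp_le_one_iff.2 (by nlinarith)
  have herr1 : 0 ≤ c * κ * η * err := by positivity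
  rw [hk12]
  rcases le_or_gt k₂ 0 with hk | hk
  · have h5 : exp (-(κ * s₁)) * (k₂ - κ * Δ) ≤ exp (-(κ * s₁)) * k₂ := by
      gcongr
      nlinarith
    have h6 : exp (-(κ * s₁)) * k₂ ≤ exp (-(κ * s₂)) * k₂ := mul_le_mul_of_nonpos_right hes hk
    linarith
  set ee := exp (-(2 * κ * η)) with hee
  have hee1 : ee ≤ 1 := exp_le_one_iff.2 (by nlinarith [mul_nonneg hκ.le hη0])
  have hee0 : 0 < ee := exp_pos _
  have heel : 1 - 2 * κ * η ≤ ee := by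
    have := add_one_le_exp (-(2 * κ * η))
    linarith
  have hG21 : G s₂ * ee ≤ G s₁ := by
    have := mul_le_mul_of_nonneg_right hgr hee0.le
    rwa [mul_assoc, ← exp_add, show 2 * κ * η + -(2 * κ * η) = 0 by ring, exp_zero,
      mul_one] at this
  have hΔF : η * ee * (F s₂ * k₂) ≤ Δ * F s₁ := by
    calc η * ee * (F s₂ * k₂) ≤ η * ee * (c * (m s₂ * G s₂)) := by gcongr
      _ = c * m s₂ * η * (G s₂ * ee) := by ring
      _ ≤ c * m s₂ * η * G s₁ := by gcongr
      _ ≤ F s₁ * (m s₁ - m s₂) * G s₁ := by gcongr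
      _ = G s₁ * (m s₁ - m s₂) * F s₁ := by ring
      _ ≤ Δ * F s₁ := by gcongr
  have hratio : 1 - err ≤ ee * (F s₂ / F s₁) := by
    have h7 : F s₂ / F s₁ = 1 - Δ / F s₁ := by rw [hΔ]; field_simp; ring
    have h8 : Δ / F s₁ ≤ Δ / F b := by gcongr; linarith
    have h9 : 0 ≤ Δ / F s₁ := by positivity
    rw [h7, herr]
    nlinarith
  have hΔl : η * k₂ * (1 - err) ≤ Δ := by
    calc η * k₂ * (1 - err) ≤ η * k₂ * (ee * (F s₂ / F s₁)) := by gcongr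
      _ = (η * ee * (F s₂ * k₂)) / F s₁ := by ring
      _ ≤ Δ * F s₁ / F s₁ := by gcongr
      _ = Δ := by field_simp
  have hexp1 : 1 - κ * η ≤ exp (-(κ * η)) := by
    have := add_one_le_exp (-(κ * η))
    linarith
  have hk1 : k₂ - κ * Δ ≤ exp (-(κ * η)) * k₂ + c * κ * η * err := by
    have h10 : κ * (η * k₂ * (1 - err)) ≤ κ * Δ := by gcongr
    have h11 : (1 - κ * η) * k₂ ≤ exp (-(κ * η)) * k₂ := by gcongr
    have h12 : κ * η * err * k₂ ≤ κ * η * err * c := by gcongr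
    linarith
  calc exp (-(κ * s₁)) * (k₂ - κ * Δ)
      ≤ exp (-(κ * s₁)) * (exp (-(κ * η)) * k₂ + c * κ * η * err) := by gcongr
    _ = exp (-(κ * s₂)) * k₂ + exp (-(κ * s₁)) * (c * κ * η * err) := by
      rw [mul_add, ← mul_assoc, ← exp_add, hη]; congr 3; ring
    _ ≤ exp (-(κ * s₂)) * k₂ + 1 * (c * κ * η * err) := by gcongr
    _ = _ := by rw [one_mul]

end IsBolProfile

theorem hasDerivAt_max_zero_sq (t : ℝ) :
    HasDerivAt (fun t : ℝ => (max t 0) ^ 2) (2 * max t 0) t := by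
  rcases lt_trichotomy t 0 with h | h | h
  · rw [max_eq_right h.le, mul_zero]
    refine (hasDerivAt_const t (0 : ℝ)).congr_of_eventuallyEq ?_
    filter_upwards [gt_mem_nhds h] with s hs
    simp [max_eq_right hs.le]
  · subst h
    rw [max_self, mul_zero, hasDerivAt_iff_isLittleO]
    have h1 : (fun t : ℝ => t ^ 2) =o[𝓝 0] fun t : ℝ => t := by
      simpa using (Asymptotics.isLittleO_pow_id (𝕜 := ℝ) (n := 2) (by norm_num))
    have h2 : (fun t : ℝ => (max t 0) ^ 2) =O[𝓝 0] fun t : ℝ => t ^ 2 := by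
      refine Asymptotics.IsBigO.of_bound 1 (Eventually.of_forall fun s => ?_)
      rw [norm_pow, norm_pow, one_mul]
      refine pow_le_pow_left₀ (norm_nonneg _) ?_ 2
      rcases le_total s 0 with hs | hs
      · simp [max_eq_right hs]
      · simp [max_eq_left hs]
    simpa using h2.trans_isLittleO h1
  · rw [max_eq_left h.le]
    have := (hasDerivAt_pow 2 t)
    refine HasDerivAt.congr_of_eventuallyEq (f := fun t : ℝ => t ^ 2) (by simpa using this) ?_
    filter_upwards [lt_mem_nhds h] with s hs
    simp [max_eq_left hs.le]

/-- A `C¹` regularisation of `t ↦ max (t - s) 0`. -/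
def ramp (s ε t : ℝ) : ℝ := ((max (t - s) 0) ^ 2 - (max (t - s - ε) 0) ^ 2) / (2 * ε)

/-- The derivative of `ramp`. -/
def rampDeriv (s ε t : ℝ) : ℝ := (max (t - s) 0 - max (t - s - ε) 0) / ε

theorem hasDerivAt_ramp (s ε t : ℝ) : HasDerivAt (ramp s ε) (rampDeriv s ε t) t := by
  have h1 : HasDerivAt (fun t : ℝ => (max (t - s) 0) ^ 2) (2 * max (t - s) 0) t := by
    simpa [Function.comp_def] using
      (hasDerivAt_max_zero_sq (t - s)).comp t ((hasDerivAt_id t).sub_const s)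
  have h2 : HasDerivAt (fun t : ℝ => (max (t - s - ε) 0) ^ 2) (2 * max (t - s - ε) 0) t := by
    simpa [Function.comp_def] using
      (hasDerivAt_max_zero_sq (t - s - ε)).comp t (((hasDerivAt_id t).sub_const s).sub_const ε)
  have h3 := (h1.sub h2).div_const (2 * ε)
  refine h3.congr_deriv ?_
  unfold rampDeriv
  rw [← mul_sub, mul_div_mul_left _ _ two_ne_zero]

theorem continuous_rampDeriv (s ε : ℝ) : Continuous (rampDeriv s ε) := by
  unfold rampDeriv
  fun_prop

theorem contDiff_ramp (s ε : ℝ) : ContDiff ℝ 1 (ramp s ε) := by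
  rw [contDiff_one_iff_deriv]
  refine ⟨fun t => (hasDerivAt_ramp s ε t).differentiableAt, ?_⟩
  have : deriv (ramp s ε) = rampDeriv s ε := funext fun t => (hasDerivAt_ramp s ε t).deriv
  rw [this]
  exact continuous_rampDeriv s ε

theorem ramp_of_le {s ε t : ℝ} (hε : 0 < ε) (h : t ≤ s) : ramp s ε t = 0 := by
  unfold ramp
  rw [max_eq_right (by linarith), max_eq_right (by linarith)]
  simp

theorem ramp_of_ge {s ε t : ℝ} (hε : 0 < ε) (h : s + ε ≤ t) :
    ramp s ε t = t - s - ε / 2 := by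
  unfold ramp
  rw [max_eq_left (by linarith), max_eq_left (by linarith)]
  field_simp
  ring

theorem ramp_mid {s ε t : ℝ} (h1 : s ≤ t) (h2 : t ≤ s + ε) :
    ramp s ε t = (t - s) ^ 2 / (2 * ε) := by
  unfold ramp
  rw [max_eq_left (by linarith), max_eq_right (by linarith)]
  simp

theorem abs_ramp_sub_le {s ε : ℝ} (hε : 0 < ε) (t : ℝ) :
    |ramp s ε t - max (t - s) 0| ≤ ε := by
  rcases le_total t s with h | h
  · rw [ramp_of_le hε h, max_eq_right (by linarith)]
    simpa using hε.le
  · rcases le_total t (s + ε) with h2 | h2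
    · rw [ramp_mid h h2, max_eq_left (by linarith)]
      have h3 : (t - s) ^ 2 / (2 * ε) ≤ t - s := by
        rw [div_le_iff₀ (by positivity)]
        nlinarith
      have h4 : 0 ≤ (t - s) ^ 2 / (2 * ε) := by positivity
      rw [abs_le]
      constructor <;> linarith
    · rw [ramp_of_ge hε h2, max_eq_left (by linarith), abs_le]
      constructor <;> linarith

theorem ramp_le_of_le {s ε t : ℝ} (hε : 0 < ε) (h : t ≤ s + ε) : ramp s ε t ≤ ε / 2 := by
  rcases le_total t s with h1 | h1
  · rw [ramp_of_le hε h1]; positivity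
  · rw [ramp_mid h1 h, div_le_iff₀ (by positivity)]
    nlinarith

theorem rampDeriv_of_le {s ε t : ℝ} (hε : 0 < ε) (h : t ≤ s) : rampDeriv s ε t = 0 := by
  unfold rampDeriv
  rw [max_eq_right (by linarith), max_eq_right (by linarith)]
  simp

theorem rampDeriv_of_ge {s ε t : ℝ} (hε : 0 < ε) (h : s + ε ≤ t) : rampDeriv s ε t = 1 := by
  unfold rampDeriv
  rw [max_eq_left (by linarith), max_eq_left (by linarith)]
  field_simp
  ring

theorem abs_rampDeriv_le_one {s ε : ℝ} (hε : 0 < ε) (t : ℝ) : |rampDeriv s ε t| ≤ 1 := by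
  rcases le_total t s with h | h
  · rw [rampDeriv_of_le hε h]; simp
  · rcases le_total t (s + ε) with h2 | h2
    · unfold rampDeriv
      rw [max_eq_left (by linarith), max_eq_right (by linarith), sub_zero,
        abs_of_nonneg (div_nonneg (by linarith) hε.le), div_le_one hε]
      linarith
    · rw [rampDeriv_of_ge hε h2]; simp

theorem tendsto_ramp (s t : ℝ) :
    Tendsto (fun k : ℕ => ramp s (1 / (k + 1 : ℝ)) t) atTop (𝓝 (max (t - s) 0)) := by
  rw [tendsto_iff_norm_sub_tendsto_zero]
  refine squeeze_zero (fun _ => norm_nonneg _) (fun k => ?_)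
    (tendsto_one_div_add_atTop_nhds_zero_nat (𝕜 := ℝ))
  exact abs_ramp_sub_le (by positivity) t

theorem tendsto_rampDeriv (s t : ℝ) :
    Tendsto (fun k : ℕ => rampDeriv s (1 / (k + 1 : ℝ)) t) atTop (𝓝 (if s < t then 1 else 0)) := by
  split_ifs with h
  · refine tendsto_const_nhds.congr' ?_
    have h1 := (tendsto_one_div_add_atTop_nhds_zero_nat (𝕜 := ℝ)).eventually
      (gt_mem_nhds (sub_pos.2 h))
    filter_upwards [h1] with k hk
    rw [rampDeriv_of_ge (by positivity) (by linarith)]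
  · refine tendsto_const_nhds.congr fun k => ?_
    rw [rampDeriv_of_le (by positivity) (not_lt.1 h)]

/-- The integral of a partial derivative of a compactly supported `C¹` function vanishes. -/
theorem integral_fderiv_apply_eq_zero {w : E2 → ℝ} (hw : ContDiff ℝ 1 w)
    (hc : HasCompactSupport w) (e : E2) : ∫ y, fderiv ℝ w y e = 0 := by
  have hd : Continuous fun y => fderiv ℝ w y e :=
    (hw.continuous_fderiv one_ne_zero).clm_apply continuous_const
  have hdc : HasCompactSupport fun y => fderiv ℝ w y e := by
    refine (hc.fderiv (𝕜 := ℝ)).comp_left (g := fun l : E2 →L[ℝ] ℝ => l e) (by simp)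
  have hdi : Integrable fun y => fderiv ℝ w y e := hd.integrable_of_hasCompactSupport hdc
  have hwi : Integrable w := hw.continuous.integrable_of_hasCompactSupport hc
  have h := integral_mul_fderiv_eq_neg_fderiv_mul_of_integrable (𝕜 := ℝ) (μ := volume)
    (f := w) (g := fun _ : E2 => (1 : ℝ)) (v := e) (by simpa using hdi) (by simp)
    (by simpa using hwi)
    (fun y _ => hw.differentiable one_ne_zero y) (fun y _ => differentiableAt_const _)
  simpa using h

/-- A classical solution of `-(∂²/∂x² + ∂²/∂y²) v = G(v)` on an open set `D` whose superlevel
set `{v ≥ a}` is compact in `D`. -/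
structure IsPiece (D : Set E2) (v : E2 → ℝ) (G : ℝ → ℝ) (a : ℝ) : Prop where
  isOpen : IsOpen D
  smooth : ContDiffOn ℝ (⊤ : ℕ∞) v D
  isCompact : IsCompact {y | y ∈ D ∧ a ≤ v y}
  pde : ∀ y ∈ D, lapl v y = G (v y)
  continuous_G : Continuous G

/-- The open superlevel set `{v > s}` in `D`. -/
def superlevel (D : Set E2) (v : E2 → ℝ) (s : ℝ) : Set E2 := {y | y ∈ D ∧ s < v y}

/-- The distribution function of `v` on `D`. -/
def levelMeasure (D : Set E2) (v : E2 → ℝ) (s : ℝ) : ℝ := volume.real (superlevel D v s)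

/-- The mass of `G(v)` above the level `s`. -/
def levelMass (D : Set E2) (v : E2 → ℝ) (G : ℝ → ℝ) (s : ℝ) : ℝ :=
  ∫ y in superlevel D v s, G (v y)

/-- The Dirichlet energy of `v` above the level `s`. -/
def levelEnergy (D : Set E2) (v : E2 → ℝ) (s : ℝ) : ℝ :=
  ∫ y in superlevel D v s, ‖gradient v y‖ ^ 2

theorem superlevel_anti (D : Set E2) (v : E2 → ℝ) {s₁ s₂ : ℝ} (h : s₁ ≤ s₂) :
    superlevel D v s₂ ⊆ superlevel D v s₁ := fun _ hy => ⟨hy.1, h.trans_lt hy.2⟩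

theorem norm_gradient_eq (v : E2 → ℝ) (y : E2) : ‖gradient v y‖ = ‖fderiv ℝ v y‖ := by
  unfold gradient
  rw [LinearIsometryEquiv.norm_map]

theorem inner_gradient_eq (v : E2 → ℝ) (y e : E2) : ⟪gradient v y, e⟫ = fderiv ℝ v y e := by
  unfold gradient
  rw [InnerProductSpace.toDual_symm_apply]

namespace IsPiece

variable {D : Set E2} {v : E2 → ℝ} {G : ℝ → ℝ} {a : ℝ}

theorem mono (P : IsPiece D v G a) {b : ℝ} (hab : a ≤ b) : IsPiece D v G b where
  isOpen := P.isOpen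
  smooth := P.smooth
  isCompact := by
    obtain ⟨C, hC, hCD⟩ := (continuousOn_iff_isClosed.1 P.smooth.continuousOn) (Set.Ici b)
      isClosed_Ici
    have : {y | y ∈ D ∧ b ≤ v y} = {y | y ∈ D ∧ a ≤ v y} ∩ C := by
      ext y
      constructor
      · intro hy
        have h1 : y ∈ v ⁻¹' Set.Ici b ∩ D := ⟨hy.2, hy.1⟩
        rw [hCD] at h1
        exact ⟨⟨hy.1, hab.trans hy.2⟩, h1.1⟩
      · intro hy
        have h1 : y ∈ C ∩ D := ⟨hy.2, hy.1.1⟩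
        rw [← hCD] at h1
        exact ⟨hy.1.1, h1.1⟩
    rw [this]
    exact P.isCompact.inter_right hC
  pde := P.pde
  continuous_G := P.continuous_G

theorem contDiffAt (P : IsPiece D v G a) {y : E2} (hy : y ∈ D) :
    ContDiffAt ℝ (⊤ : ℕ∞) v y :=
  P.smooth.contDiffAt (P.isOpen.mem_nhds hy)

theorem differentiableAt (P : IsPiece D v G a) {y : E2} (hy : y ∈ D) :
    DifferentiableAt ℝ v y :=
  (P.contDiffAt hy).differentiableAt (by simp)

theorem isOpen_superlevel (P : IsPiece D v G a) (s : ℝ) : IsOpen (superlevel D v s) :=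
  P.smooth.continuousOn.isOpen_inter_preimage P.isOpen isOpen_Ioi

theorem _root_.superlevel_subset {s : ℝ} (hs : a ≤ s) :
    superlevel D v s ⊆ {y | y ∈ D ∧ a ≤ v y} := fun _ hy => ⟨hy.1, hs.trans hy.2.le⟩

theorem volume_superlevel_lt_top (P : IsPiece D v G a) {s : ℝ} (hs : a ≤ s) :
    volume (superlevel D v s) < ⊤ :=
  (measure_mono (superlevel_subset hs)).trans_lt P.isCompact.measure_lt_top

theorem integrableOn_of_continuousOn (P : IsPiece D v G a) {f : E2 → ℝ} (hf : ContinuousOn f D)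
    {s : ℝ} (hs : a ≤ s) : IntegrableOn f (superlevel D v s) :=
  ((hf.mono fun _ hy => hy.1).integrableOn_compact P.isCompact).mono_set
    (superlevel_subset hs)

theorem continuousOn_fderiv (P : IsPiece D v G a) : ContinuousOn (fderiv ℝ v) D :=
  P.smooth.continuousOn_fderiv_of_isOpen P.isOpen (by simp)

theorem continuousOn_gradient_norm_sq (P : IsPiece D v G a) :
    ContinuousOn (fun y => ‖gradient v y‖ ^ 2) D := by
  simp only [norm_gradient_eq]
  exact (P.continuousOn_fderiv.norm).pow 2

theorem continuousOn_G (P : IsPiece D v G a) : ContinuousOn (fun y => G (v y)) D :=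
  P.continuous_G.comp_continuousOn P.smooth.continuousOn

theorem continuousOn_norm_fderiv (P : IsPiece D v G a) :
    ContinuousOn (fun y => ‖fderiv ℝ v y‖) D := P.continuousOn_fderiv.norm

/-- A function on `D` supported where `v > a` extends by zero to a compactly supported
function. -/
theorem tsupport_subset (P : IsPiece D v G a) {f : E2 → ℝ}
    (hf : ∀ y ∉ {y | y ∈ D ∧ a ≤ v y}, f y = 0) : tsupport f ⊆ {y | y ∈ D ∧ a ≤ v y} :=
  closure_minimal (fun y hy => by by_contra h; exact hy (hf y h)) P.isCompact.isClosed

theorem hasCompactSupport (P : IsPiece D v G a) {f : E2 → ℝ}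
    (hf : ∀ y ∉ {y | y ∈ D ∧ a ≤ v y}, f y = 0) : HasCompactSupport f :=
  HasCompactSupport.of_support_subset_isCompact P.isCompact
    ((subset_tsupport f).trans (P.tsupport_subset hf))

theorem contDiff_extend (P : IsPiece D v G a) {f : E2 → ℝ} (hf : ContDiffOn ℝ 1 f D)
    (hf0 : ∀ y ∉ {y | y ∈ D ∧ a ≤ v y}, f y = 0) : ContDiff ℝ 1 f := by
  rw [contDiff_iff_contDiffAt]
  intro y
  by_cases hy : y ∈ tsupport f
  · exact hf.contDiffAt (P.isOpen.mem_nhds (P.tsupport_subset hf0 hy).1)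
  · exact contDiffAt_const.congr_of_eventuallyEq (notMem_tsupport_iff_eventuallyEq.1 hy)

theorem contDiff_indicator (P : IsPiece D v G a) {χ : ℝ → ℝ} (hχ : ContDiff ℝ 1 χ)
    (hχ0 : ∀ t ≤ a, χ t = 0) :
    ContDiff ℝ 1 (D.indicator fun y => χ (v y)) ∧
      HasCompactSupport (D.indicator fun y => χ (v y)) := by
  have h0 : ∀ y ∉ {y | y ∈ D ∧ a ≤ v y}, D.indicator (fun y => χ (v y)) y = 0 := by
    intro y hy
    by_cases hD : y ∈ D
    · rw [Set.indicator_of_mem hD]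
      exact hχ0 _ (by by_contra h; exact hy ⟨hD, (not_le.1 h).le⟩)
    · rw [Set.indicator_of_notMem hD]
  refine ⟨P.contDiff_extend ?_ h0, P.hasCompactSupport h0⟩
  have : ContDiffOn ℝ 1 (fun y => χ (v y)) D := hχ.comp_contDiffOn (P.smooth.of_le (by simp))
  exact this.congr fun y hy => by rw [Set.indicator_of_mem hy]

theorem fderiv_indicator (P : IsPiece D v G a) {χ : ℝ → ℝ} {y : E2} (hy : y ∈ D) {c : ℝ}
    (hχ : HasDerivAt χ c (v y)) :
    fderiv ℝ (D.indicator fun y => χ (v y)) y = c • fderiv ℝ v y := by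
  have h1 : D.indicator (fun y => χ (v y)) =ᶠ[𝓝 y] fun y => χ (v y) := by
    filter_upwards [P.isOpen.mem_nhds hy] with z hz
    rw [Set.indicator_of_mem hz]
  rw [h1.fderiv_eq]
  exact (hχ.comp_hasFDerivAt y (P.differentiableAt hy).hasFDerivAt).fderiv

/-- The weak form of the equation, tested against a function of `v`. -/
theorem integral_test (P : IsPiece D v G a) {χ χ' : ℝ → ℝ} (hχ : ContDiff ℝ 1 χ)
    (hχ' : ∀ t, HasDerivAt χ (χ' t) t) (hχ0 : ∀ t ≤ a, χ t = 0) (hχ'0 : ∀ t ≤ a, χ' t = 0) :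
    ∫ y in superlevel D v a, χ' (v y) * ‖gradient v y‖ ^ 2 =
      ∫ y in superlevel D v a, χ (v y) * G (v y) := by
  set e : Fin 2 → E2 := fun i => EuclideanSpace.single i 1 with he
  set u : E2 → ℝ := D.indicator fun y => χ (v y) with hu
  obtain ⟨hu1, huc⟩ := P.contDiff_indicator hχ hχ0
  have hu0 : ∀ y ∉ {y | y ∈ D ∧ a ≤ v y}, u y = 0 := by
    intro y hy
    by_cases hD : y ∈ D
    · rw [hu, Set.indicator_of_mem hD]
      exact hχ0 _ (by by_contra h; exact hy ⟨hD, (not_le.1 h).le⟩)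
    · rw [hu, Set.indicator_of_notMem hD]
  have hdv : ContDiffOn ℝ 1 (fderiv ℝ v) D :=
    P.smooth.fderiv_of_isOpen P.isOpen (by norm_cast)
  have hdvi : ∀ i, ContDiffOn ℝ 1 (fun y => fderiv ℝ v y (e i)) D := fun i =>
    hdv.clm_apply contDiffOn_const
  have hw0 : ∀ i, ∀ y ∉ {y | y ∈ D ∧ a ≤ v y}, u y * fderiv ℝ v y (e i) = 0 := fun i y hy => by
    rw [hu0 y hy, zero_mul]
  have hw1 : ∀ i, ContDiff ℝ 1 fun y => u y * fderiv ℝ v y (e i) := fun i =>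
    P.contDiff_extend (hu1.contDiffOn.mul (hdvi i)) (hw0 i)
  have hwc : ∀ i, HasCompactSupport fun y => u y * fderiv ℝ v y (e i) := fun i =>
    P.hasCompactSupport (hw0 i)
  have hint : ∀ i, Integrable fun y => fderiv ℝ (fun y => u y * fderiv ℝ v y (e i)) y (e i) := by
    intro i
    have hd : Continuous fun y => fderiv ℝ (fun y => u y * fderiv ℝ v y (e i)) y (e i) :=
      ((hw1 i).continuous_fderiv one_ne_zero).clm_apply continuous_const
    refine hd.integrable_of_hasCompactSupport ?_
    exact ((hwc i).fderiv (𝕜 := ℝ)).comp_left (g := fun l : E2 →L[ℝ] ℝ => l (e i)) (by simp)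
  have hsum : ∫ y, ∑ i, fderiv ℝ (fun y => u y * fderiv ℝ v y (e i)) y (e i) = 0 := by
    rw [integral_finsetSum _ fun i _ => hint i]
    exact Finset.sum_eq_zero fun i _ => integral_fderiv_apply_eq_zero (hw1 i) (hwc i) (e i)
  have hpt : ∀ y ∈ D, ∑ i, fderiv ℝ (fun y => u y * fderiv ℝ v y (e i)) y (e i) =
      χ' (v y) * ‖gradient v y‖ ^ 2 - χ (v y) * G (v y) := by
    intro y hy
    have h1 : ∀ i, fderiv ℝ (fun y => u y * fderiv ℝ v y (e i)) y (e i) =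
        χ (v y) * iteratedFDeriv ℝ 2 v y ![e i, e i] +
          χ' (v y) * (fderiv ℝ v y (e i)) ^ 2 := by
      intro i
      have hdy : DifferentiableAt ℝ (fderiv ℝ v) y :=
        ((hdv.contDiffAt (P.isOpen.mem_nhds hy)).differentiableAt one_ne_zero)
      have hdy' : HasFDerivAt (fun y => fderiv ℝ v y (e i))
          ((fderiv ℝ (fderiv ℝ v) y).flip (e i)) y := by
        have := hdy.hasFDerivAt.clm_apply (hasFDerivAt_const (e i) y)
        simpa using this
      have hprod : HasFDerivAt (fun y => u y * fderiv ℝ v y (e i)) _ y :=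
        (hu1.differentiable one_ne_zero y).hasFDerivAt.mul hdy'
      rw [hprod.fderiv, iteratedFDeriv_two_apply, P.fderiv_indicator hy (hχ' (v y)),
        Set.indicator_of_mem hy]
      simp
      ring
    rw [Finset.sum_congr rfl fun i _ => h1 i, Finset.sum_add_distrib, ← Finset.mul_sum,
      ← Finset.mul_sum]
    have h2 : ∑ i, iteratedFDeriv ℝ 2 v y ![e i, e i] = -G (v y) := by
      rw [← P.pde y hy]
      simp [lapl, he]
    have h3 : ∑ i, (fderiv ℝ v y (e i)) ^ 2 = ‖gradient v y‖ ^ 2 := by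
      rw [EuclideanSpace.norm_sq_eq]
      refine Finset.sum_congr rfl fun i _ => ?_
      rw [← inner_gradient_eq, he, EuclideanSpace.inner_single_right]
      simp
    rw [h2, h3]
    ring
  have hzero : ∀ y ∉ superlevel D v a,
      ∑ i, fderiv ℝ (fun y => u y * fderiv ℝ v y (e i)) y (e i) = 0 := by
    intro y hy
    by_cases hD : y ∈ D
    · have hva : v y ≤ a := by by_contra h; exact hy ⟨hD, not_le.1 h⟩
      rw [hpt y hD, hχ0 _ hva, hχ'0 _ hva]
      simp
    · refine Finset.sum_eq_zero fun i _ => ?_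
      have : y ∉ tsupport fun y => u y * fderiv ℝ v y (e i) := fun h =>
        hD (P.tsupport_subset (hw0 i) h).1
      have h4 := image_eq_zero_of_notMem_tsupport (fun h => this (tsupport_fderiv_subset ℝ h))
      rw [h4]
      simp
  rw [← setIntegral_eq_integral_of_forall_compl_eq_zero hzero,
    setIntegral_congr_fun (P.isOpen_superlevel a).measurableSet fun y hy => hpt y hy.1,
    MeasureTheory.integral_sub] at hsum
  · linarith
  · refine P.integrableOn_of_continuousOn ?_ le_rfl
    have hc : Continuous χ' := by
      have : deriv χ = χ' := funext fun t => (hχ' t).deriv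
      rw [← this]
      exact hχ.continuous_deriv le_rfl
    exact (hc.comp_continuousOn P.smooth.continuousOn).mul P.continuousOn_gradient_norm_sq
  · exact P.integrableOn_of_continuousOn
      ((hχ.continuous.comp_continuousOn P.smooth.continuousOn).mul P.continuousOn_G) le_rfl

end IsPiece

theorem sq_setIntegral_le {g : E2 → ℝ} {S : Set E2} (hS : volume S ≠ ⊤)
    (hg : IntegrableOn g S) (hg2 : IntegrableOn (fun y => g y ^ 2) S) :
    (∫ y in S, g y) ^ 2 ≤ volume.real S * ∫ y in S, g y ^ 2 := by
  have key : ∀ t : ℝ, 0 ≤ volume.real S * (t * t) + (-2 * ∫ y in S, g y) * t +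
      ∫ y in S, g y ^ 2 := by
    intro t
    have h0 : 0 ≤ ∫ y in S, (g y - t) ^ 2 := integral_nonneg fun y => sq_nonneg _
    have h1 : ∫ y in S, (g y - t) ^ 2 =
        ∫ y in S, (g y ^ 2 - (2 * t) * g y + t ^ 2) := by
      congr 1; ext y; ring
    have hc : IntegrableOn (fun _ : E2 => t ^ 2) S := integrableOn_const hS
    have hd : IntegrableOn (fun y => g y ^ 2 - 2 * t * g y) S := hg2.sub (hg.const_mul (2 * t))
    rw [h1, MeasureTheory.integral_add hd hc,
      MeasureTheory.integral_sub hg2 (hg.const_mul (2 * t)), MeasureTheory.integral_const_mul,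
      setIntegral_const, smul_eq_mul] at h0
    linarith
  have := discrim_le_zero key
  rw [discrim] at this
  linarith

namespace IsPiece

variable {D : Set E2} {v : E2 → ℝ} {G : ℝ → ℝ} {a : ℝ}

theorem continuousOn_sub_mul_G (P : IsPiece D v G a) (s : ℝ) :
    ContinuousOn (fun y => (v y - s) * G (v y)) D :=
  (P.smooth.continuousOn.sub continuousOn_const).mul P.continuousOn_G

/-- The energy above the level `s` in terms of the mass. -/
theorem levelEnergy_eq (P : IsPiece D v G a) {s : ℝ} (hs : a ≤ s) :
    levelEnergy D v s = ∫ y in superlevel D v s, (v y - s) * G (v y) := by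
  have Q := P.mono hs
  have hmeas := (Q.isOpen_superlevel s).measurableSet
  have hε : ∀ k : ℕ, (0 : ℝ) < 1 / (k + 1 : ℝ) := fun k => by positivity
  have h1 : Tendsto (fun k : ℕ => ∫ y in superlevel D v s,
      rampDeriv s (1 / (k + 1 : ℝ)) (v y) * ‖gradient v y‖ ^ 2) atTop
      (𝓝 (levelEnergy D v s)) := by
    refine tendsto_integral_of_dominated_convergence (fun y => ‖gradient v y‖ ^ 2) ?_ ?_ ?_ ?_
    · intro k
      exact (Q.integrableOn_of_continuousOn (((continuous_rampDeriv _ _).comp_continuousOn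
        P.smooth.continuousOn).mul P.continuousOn_gradient_norm_sq) le_rfl).aestronglyMeasurable
    · exact Q.integrableOn_of_continuousOn P.continuousOn_gradient_norm_sq le_rfl
    · intro k
      refine Eventually.of_forall fun y => ?_
      rw [norm_mul, Real.norm_eq_abs, Real.norm_of_nonneg (sq_nonneg _)]
      exact mul_le_of_le_one_left (sq_nonneg _) (abs_rampDeriv_le_one (hε k) _)
    · filter_upwards [ae_restrict_mem hmeas] with y hy
      have := (tendsto_rampDeriv s (v y)).mul_const (‖gradient v y‖ ^ 2)
      rwa [if_pos hy.2, one_mul] at this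
  have h2 : Tendsto (fun k : ℕ => ∫ y in superlevel D v s,
      ramp s (1 / (k + 1 : ℝ)) (v y) * G (v y)) atTop
      (𝓝 (∫ y in superlevel D v s, (v y - s) * G (v y))) := by
    refine tendsto_integral_of_dominated_convergence
      (fun y => (|v y - s| + 1) * |G (v y)|) ?_ ?_ ?_ ?_
    · intro k
      exact (Q.integrableOn_of_continuousOn (((contDiff_ramp _ _).continuous.comp_continuousOn
        P.smooth.continuousOn).mul P.continuousOn_G) le_rfl).aestronglyMeasurable
    · exact Q.integrableOn_of_continuousOn ((((P.smooth.continuousOn.sub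
        continuousOn_const).abs).add continuousOn_const).mul P.continuousOn_G.abs) le_rfl
    · intro k
      filter_upwards [ae_restrict_mem hmeas] with y hy
      rw [norm_mul, Real.norm_eq_abs, Real.norm_eq_abs]
      gcongr
      have h3 := abs_ramp_sub_le (s := s) (hε k) (v y)
      rw [max_eq_left (sub_nonneg.2 hy.2.le)] at h3
      have h4 : (1 : ℝ) / (k + 1 : ℝ) ≤ 1 := by
        rw [div_le_one (by positivity)]
        linarith [(k.cast_nonneg : (0 : ℝ) ≤ k)]
      have h5 := abs_sub_abs_le_abs_sub (ramp s (1 / (k + 1 : ℝ)) (v y)) (v y - s)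
      linarith
    · filter_upwards [ae_restrict_mem hmeas] with y hy
      have := (tendsto_ramp s (v y)).mul_const (G (v y))
      rwa [max_eq_left (sub_nonneg.2 hy.2.le)] at this
  refine tendsto_nhds_unique h1 (h2.congr fun k => ?_)
  exact (Q.integral_test (contDiff_ramp s _) (hasDerivAt_ramp s _)
    (fun t ht => ramp_of_le (hε k) ht) (fun t ht => rampDeriv_of_le (hε k) ht)).symm

theorem setIntegral_sub_superlevel (P : IsPiece D v G a) {f : E2 → ℝ} (hf : ContinuousOn f D)
    {s₁ s₂ : ℝ} (h1 : a ≤ s₁) (h12 : s₁ ≤ s₂) :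
    (∫ y in superlevel D v s₁, f y) - ∫ y in superlevel D v s₂, f y =
      ∫ y in superlevel D v s₁ \ superlevel D v s₂, f y :=
  (setIntegral_sdiff (P.isOpen_superlevel s₂).measurableSet
    (P.integrableOn_of_continuousOn hf h1) (superlevel_anti D v h12)).symm

theorem levelMeasure_sub (P : IsPiece D v G a) {s₁ s₂ : ℝ} (h1 : a ≤ s₁) (h12 : s₁ ≤ s₂) :
    levelMeasure D v s₁ - levelMeasure D v s₂ =
      volume.real (superlevel D v s₁ \ superlevel D v s₂) :=
  (measureReal_sdiff (superlevel_anti D v h12) (P.isOpen_superlevel s₂).measurableSet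
    (P.volume_superlevel_lt_top h1).ne).symm

theorem levelMeasure_anti (P : IsPiece D v G a) {s₁ s₂ : ℝ} (h1 : a ≤ s₁) (h12 : s₁ ≤ s₂) :
    levelMeasure D v s₂ ≤ levelMeasure D v s₁ := by
  have := P.levelMeasure_sub h1 h12
  linarith [measureReal_nonneg (μ := volume) (s := superlevel D v s₁ \ superlevel D v s₂)]

theorem levelEnergy_anti (P : IsPiece D v G a) {s₁ s₂ : ℝ} (h1 : a ≤ s₁) (h12 : s₁ ≤ s₂) :
    levelEnergy D v s₂ ≤ levelEnergy D v s₁ := by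
  have := P.setIntegral_sub_superlevel P.continuousOn_gradient_norm_sq h1 h12
  have h3 : 0 ≤ ∫ y in superlevel D v s₁ \ superlevel D v s₂, ‖gradient v y‖ ^ 2 :=
    integral_nonneg fun y => sq_nonneg _
  unfold levelEnergy
  linarith

theorem mul_levelMass_le (P : IsPiece D v G a) (hG : ∀ t, a ≤ t → 0 ≤ G t) {s₁ s₂ : ℝ}
    (h1 : a ≤ s₁) (h12 : s₁ ≤ s₂) :
    (s₂ - s₁) * levelMass D v G s₂ ≤ levelEnergy D v s₁ - levelEnergy D v s₂ := by
  rw [P.levelEnergy_eq h1, P.levelEnergy_eq (h1.trans h12)]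
  have e := P.setIntegral_sub_superlevel (P.continuousOn_sub_mul_G s₁) h1 h12
  have h3 : 0 ≤ ∫ y in superlevel D v s₁ \ superlevel D v s₂, (v y - s₁) * G (v y) := by
    refine setIntegral_nonneg ((P.isOpen_superlevel s₁).measurableSet.diff
      (P.isOpen_superlevel s₂).measurableSet) fun y hy => ?_
    exact mul_nonneg (sub_nonneg.2 hy.1.2.le) (hG _ (h1.trans hy.1.2.le))
  have h4 : ∫ y in superlevel D v s₂, (v y - s₁) * G (v y) =
      (s₂ - s₁) * levelMass D v G s₂ + ∫ y in superlevel D v s₂, (v y - s₂) * G (v y) := by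
    unfold levelMass
    rw [← MeasureTheory.integral_const_mul, ← MeasureTheory.integral_add]
    · congr 1; ext y; ring
    · exact (P.integrableOn_of_continuousOn P.continuousOn_G (h1.trans h12)).const_mul _
    · exact P.integrableOn_of_continuousOn (P.continuousOn_sub_mul_G s₂) (h1.trans h12)
  linarith

theorem levelEnergy_sub_le (P : IsPiece D v G a) (hG : ∀ t, a ≤ t → 0 ≤ G t) {s₁ s₂ : ℝ}
    (h1 : a ≤ s₁) (h12 : s₁ ≤ s₂) :
    levelEnergy D v s₁ - levelEnergy D v s₂ ≤ (s₂ - s₁) * levelMass D v G s₁ := by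
  rw [P.levelEnergy_eq h1, P.levelEnergy_eq (h1.trans h12)]
  have e := P.setIntegral_sub_superlevel (P.continuousOn_sub_mul_G s₂) h1 h12
  have h3 : ∫ y in superlevel D v s₁ \ superlevel D v s₂, (v y - s₂) * G (v y) ≤ 0 := by
    refine setIntegral_nonpos ((P.isOpen_superlevel s₁).measurableSet.diff
      (P.isOpen_superlevel s₂).measurableSet) fun y hy => ?_
    have h5 : v y ≤ s₂ := by by_contra h; exact hy.2 ⟨hy.1.1, not_le.1 h⟩
    exact mul_nonpos_of_nonpos_of_nonneg (by linarith) (hG _ (h1.trans hy.1.2.le))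
  have h4 : ∫ y in superlevel D v s₁, (v y - s₁) * G (v y) =
      (s₂ - s₁) * levelMass D v G s₁ + ∫ y in superlevel D v s₁, (v y - s₂) * G (v y) := by
    unfold levelMass
    rw [← MeasureTheory.integral_const_mul, ← MeasureTheory.integral_add]
    · congr 1; ext y; ring
    · exact (P.integrableOn_of_continuousOn P.continuousOn_G h1).const_mul _
    · exact P.integrableOn_of_continuousOn (P.continuousOn_sub_mul_G s₂) h1
  linarith

theorem volume_diff_ne_top (P : IsPiece D v G a) {s₁ s₂ : ℝ} (h1 : a ≤ s₁) :
    volume (superlevel D v s₁ \ superlevel D v s₂) ≠ ⊤ :=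
  ((measure_mono Set.sdiff_subset).trans_lt (P.volume_superlevel_lt_top h1)).ne

theorem integrableOn_diff (P : IsPiece D v G a) {f : E2 → ℝ} (hf : ContinuousOn f D)
    {s₁ s₂ : ℝ} (h1 : a ≤ s₁) : IntegrableOn f (superlevel D v s₁ \ superlevel D v s₂) :=
  (P.integrableOn_of_continuousOn hf h1).mono_set Set.sdiff_subset

theorem mul_levelMeasure_sub_le (P : IsPiece D v G a) (hG : MonotoneOn G (Set.Ici a)) {s₁ s₂ : ℝ}
    (h1 : a ≤ s₁) (h12 : s₁ ≤ s₂) :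
    G s₁ * (levelMeasure D v s₁ - levelMeasure D v s₂) ≤
      levelMass D v G s₁ - levelMass D v G s₂ := by
  have e : levelMass D v G s₁ - levelMass D v G s₂ = _ :=
    P.setIntegral_sub_superlevel P.continuousOn_G h1 h12
  rw [e, P.levelMeasure_sub h1 h12, mul_comm, ← smul_eq_mul, ← setIntegral_const]
  refine setIntegral_mono_on (integrableOn_const (P.volume_diff_ne_top h1))
    (P.integrableOn_diff P.continuousOn_G h1)
    ((P.isOpen_superlevel s₁).measurableSet.diff (P.isOpen_superlevel s₂).measurableSet)
    fun y hy => ?_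
  exact hG h1 (h1.trans hy.1.2.le) hy.1.2.le

theorem levelMass_sub_le (P : IsPiece D v G a) (hG : MonotoneOn G (Set.Ici a)) {s₁ s₂ : ℝ}
    (h1 : a ≤ s₁) (h12 : s₁ ≤ s₂) :
    levelMass D v G s₁ - levelMass D v G s₂ ≤
      G s₂ * (levelMeasure D v s₁ - levelMeasure D v s₂) := by
  have e : levelMass D v G s₁ - levelMass D v G s₂ = _ :=
    P.setIntegral_sub_superlevel P.continuousOn_G h1 h12
  rw [e, P.levelMeasure_sub h1 h12, mul_comm, ← smul_eq_mul, ← setIntegral_const]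
  refine setIntegral_mono_on (P.integrableOn_diff P.continuousOn_G h1)
    (integrableOn_const (P.volume_diff_ne_top h1))
    ((P.isOpen_superlevel s₁).measurableSet.diff (P.isOpen_superlevel s₂).measurableSet)
    fun y hy => ?_
  have h5 : v y ≤ s₂ := by by_contra h; exact hy.2 ⟨hy.1.1, not_le.1 h⟩
  exact hG (h1.trans hy.1.2.le) (h1.trans h12) h5

/-- The isoperimetric inequality for superlevel sets combined with Cauchy–Schwarz. -/
theorem levelMeasure_mul_sq_le (P : IsPiece D v G a) {s₁ s₂ : ℝ}
    (h1 : a < s₁) (h12 : s₁ < s₂) :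
    4 * π * levelMeasure D v s₂ * (s₂ - s₁) ^ 2 ≤
      (levelMeasure D v s₁ - levelMeasure D v s₂) * (levelEnergy D v s₁ - levelEnergy D v s₂) := by
  set ε := s₁ - a with hε
  have hε0 : 0 < ε := sub_pos.2 h1
  obtain ⟨hu1, huc⟩ := P.contDiff_indicator (contDiff_ramp a ε) fun t ht => ramp_of_le hε0 ht
  set u : E2 → ℝ := D.indicator fun y => ramp a ε (v y) with hu
  have hge : ∀ y ∈ D, s₁ ≤ v y → u y = v y - a - ε / 2 := fun y hy h => by
    rw [hu, Set.indicator_of_mem hy, ramp_of_ge hε0 (by linarith)]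
  have hlt : ∀ y, ¬(y ∈ D ∧ s₁ ≤ v y) → u y ≤ ε / 2 := fun y hy => by
    by_cases hD : y ∈ D
    · rw [hu, Set.indicator_of_mem hD]
      refine ramp_le_of_le hε0 ?_
      have : ¬ s₁ ≤ v y := fun h => hy ⟨hD, h⟩
      linarith
    · rw [hu, Set.indicator_of_notMem hD]; positivity
  have hsup : ∀ s, s₁ ≤ s → ∀ y, s - a - ε / 2 < u y ↔ y ∈ superlevel D v s := by
    intro s hs y
    by_cases hy : y ∈ D ∧ s₁ ≤ v y
    · rw [hge y hy.1 hy.2]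
      refine ⟨fun h => ⟨hy.1, by linarith⟩, fun h => ?_⟩
      have := h.2
      linarith
    · refine ⟨fun h => ?_, fun h => absurd ⟨h.1, hs.trans h.2.le⟩ hy⟩
      have := hlt y hy
      linarith
  have hiso := isoperimetric_strip hu1 huc (s₁ := s₁ - a - ε / 2) (s₂ := s₂ - a - ε / 2)
    (by linarith) (by linarith)
  have hset1 : {y | s₂ - a - ε / 2 < u y} = superlevel D v s₂ := Set.ext fun y => hsup s₂ h12.le y
  have hset2 : {y | s₁ - a - ε / 2 < u y ∧ u y ≤ s₂ - a - ε / 2} =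
      superlevel D v s₁ \ superlevel D v s₂ := by
    ext y
    rw [Set.mem_sdiff, ← hsup s₁ le_rfl y, ← hsup s₂ h12.le y, not_lt]
    rfl
  have hms := (P.isOpen_superlevel s₁).measurableSet.diff (P.isOpen_superlevel s₂).measurableSet
  rw [hset1, hset2, setIntegral_congr_fun (g := fun y => ‖gradient v y‖) hms] at hiso
  · have hgc : ContinuousOn (fun y => ‖gradient v y‖) D := by
      simp only [norm_gradient_eq]
      exact P.continuousOn_norm_fderiv
    have hcs := sq_setIntegral_le (P.volume_diff_ne_top (s₂ := s₂) h1.le)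
      (P.integrableOn_diff hgc h1.le) (P.integrableOn_diff P.continuousOn_gradient_norm_sq h1.le)
    have e : levelEnergy D v s₁ - levelEnergy D v s₂ = _ :=
      P.setIntegral_sub_superlevel P.continuousOn_gradient_norm_sq h1.le h12.le
    rw [e, P.levelMeasure_sub h1.le h12.le]
    refine le_trans ?_ hcs
    have hm0 : 0 ≤ levelMeasure D v s₂ := measureReal_nonneg
    have h7 : 0 ≤ (s₂ - s₁) * (2 * √(π * levelMeasure D v s₂)) := by
      have : 0 ≤ s₂ - s₁ := by linarith
      positivity
    have h8 : s₂ - a - ε / 2 - (s₁ - a - ε / 2) = s₂ - s₁ := by ring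
    rw [h8] at hiso
    have h9 := pow_le_pow_left₀ h7 hiso 2
    refine le_trans (le_of_eq ?_) h9
    rw [mul_pow, mul_pow, Real.sq_sqrt (by positivity)]
    ring
  · intro y hy
    have h10 : y ∈ superlevel D v s₁ := hy.1
    have h11 : u =ᶠ[𝓝 y] fun z => v z - (a + ε / 2) := by
      filter_upwards [(P.isOpen_superlevel s₁).mem_nhds h10] with z hz
      rw [hge z hz.1 hz.2.le]
      ring
    simp only
    rw [h11.fderiv_eq, norm_gradient_eq, fderiv_sub_const]

theorem levelMeasure_mul_le (P : IsPiece D v G a) (hG : ∀ t, a ≤ t → 0 ≤ G t) {s₁ s₂ : ℝ}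
    (h1 : a < s₁) (h12 : s₁ ≤ s₂) :
    4 * π * levelMeasure D v s₂ * (s₂ - s₁) ≤
      levelMass D v G s₁ * (levelMeasure D v s₁ - levelMeasure D v s₂) := by
  have hm := P.levelMeasure_anti h1.le h12
  rcases h12.eq_or_lt with rfl | h12'
  · simp
  have h3 := P.levelMeasure_mul_sq_le h1 h12'
  have h4 := P.levelEnergy_sub_le hG h1.le h12
  have h5 := mul_le_mul_of_nonneg_left h4 (sub_nonneg.2 hm)
  refine le_of_mul_le_mul_right ?_ (sub_pos.2 h12')
  linarith

end IsPiece

/-- The Moser–Trudinger nonlinearity. -/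
def mtNonlin (A L s : ℝ) : ℝ := s * (A + L * exp (s ^ 2))

theorem continuous_mtNonlin (A L : ℝ) : Continuous (mtNonlin A L) := by
  unfold mtNonlin
  fun_prop

theorem mtNonlin_pos {A L s : ℝ} (hA : 0 ≤ A) (hL : 0 < L) (hs : 0 < s) : 0 < mtNonlin A L s := by
  unfold mtNonlin
  positivity

theorem mtNonlin_mono {A L s₁ s₂ : ℝ} (hA : 0 ≤ A) (hL : 0 < L) (h1 : 0 ≤ s₁) (h12 : s₁ ≤ s₂) :
    mtNonlin A L s₁ ≤ mtNonlin A L s₂ := by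
  unfold mtNonlin
  have : 0 ≤ s₂ := h1.trans h12
  gcongr

theorem mtNonlin_growth {A L s₀ s₁ s₂ γ : ℝ} (hA : 0 ≤ A) (hL : 0 < L) (h0 : 0 < s₀)
    (h1 : s₀ ≤ s₁) (h12 : s₁ ≤ s₂) (h2 : s₂ ≤ γ) :
    mtNonlin A L s₂ ≤ mtNonlin A L s₁ * exp (2 * (γ + 1 / (2 * s₀)) * (s₂ - s₁)) := by
  unfold mtNonlin
  have hs1 : 0 < s₁ := h0.trans_le h1
  have hs2 : 0 < s₂ := hs1.trans_le h12
  have hη : 0 ≤ s₂ - s₁ := sub_nonneg.2 h12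
  have e1 : s₂ ≤ s₁ * exp ((s₂ - s₁) / s₀) := by
    have h3 := add_one_le_exp ((s₂ - s₁) / s₀)
    have h4 : (s₂ - s₁) / s₁ ≤ (s₂ - s₁) / s₀ := by gcongr
    calc s₂ = s₁ * ((s₂ - s₁) / s₁ + 1) := by field_simp; ring
      _ ≤ s₁ * exp ((s₂ - s₁) / s₀) := by gcongr; linarith
  have e2 : A + L * exp (s₂ ^ 2) ≤ (A + L * exp (s₁ ^ 2)) * exp (2 * γ * (s₂ - s₁)) := by
    have h3 : exp (s₂ ^ 2) ≤ exp (s₁ ^ 2) * exp (2 * γ * (s₂ - s₁)) := by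
      rw [← exp_add]
      refine exp_le_exp.2 ?_
      nlinarith
    have h4 : 1 ≤ exp (2 * γ * (s₂ - s₁)) := by
      refine one_le_exp ?_
      have : 0 ≤ γ := by linarith
      positivity
    have h5 : A ≤ A * exp (2 * γ * (s₂ - s₁)) := le_mul_of_one_le_right hA h4
    have h6 := mul_le_mul_of_nonneg_left h3 hL.le
    linarith
  calc s₂ * (A + L * exp (s₂ ^ 2))
      ≤ (s₁ * exp ((s₂ - s₁) / s₀)) * ((A + L * exp (s₁ ^ 2)) * exp (2 * γ * (s₂ - s₁))) := by
        gcongr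
    _ = s₁ * (A + L * exp (s₁ ^ 2)) * (exp ((s₂ - s₁) / s₀) * exp (2 * γ * (s₂ - s₁))) := by ring
    _ = _ := by
      rw [← exp_add]
      congr 2
      field_simp
      ring

namespace IsPiece

variable {D : Set E2} {v : E2 → ℝ} {A L a : ℝ}

theorem mtNonlin_nonneg_of_le (ha : 0 < a) (hA : 0 ≤ A) (hL : 0 < L) :
    ∀ t, a ≤ t → 0 ≤ mtNonlin A L t := fun _ ht => (mtNonlin_pos hA hL (ha.trans_le ht)).le

theorem mtNonlin_monotoneOn (ha : 0 < a) (hA : 0 ≤ A) (hL : 0 < L) :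
    MonotoneOn (mtNonlin A L) (Set.Ici a) := fun _ hs _ _ hst =>
  mtNonlin_mono hA hL (ha.le.trans hs) hst

theorem isBolProfile (P : IsPiece D v (mtNonlin A L) a) (ha : 0 < a) (hA : 0 ≤ A) (hL : 0 < L)
    {s₀ γ : ℝ} (hs0 : a < s₀) (hγ0 : 0 < γ) (hγ : ∀ y ∈ D, v y ≤ γ) :
    IsBolProfile (levelMeasure D v) (levelMass D v (mtNonlin A L)) (mtNonlin A L)
      (γ + 1 / (2 * s₀)) s₀ γ := by
  have hs0' : 0 < s₀ := ha.trans hs0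
  have hempty : superlevel D v γ = ∅ :=
    Set.eq_empty_of_forall_notMem fun y hy => (hγ y hy.1).not_gt hy.2
  exact {
    kappa_pos := by positivity
    nonneg := hs0'.le
    antitone := fun s₁ s₂ h0 h12 _ => P.levelMeasure_anti (hs0.le.trans h0) h12
    m_top := by simp [levelMeasure, hempty]
    F_top := by simp [levelMass, hempty]
    G_pos := fun s h0 _ => mtNonlin_pos hA hL (hs0'.trans_le h0)
    le_sub := fun s₁ s₂ h0 h12 _ =>
      P.mul_levelMeasure_sub_le (mtNonlin_monotoneOn ha hA hL) (hs0.le.trans h0) h12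
    sub_le := fun s₁ s₂ h0 h12 _ =>
      P.levelMass_sub_le (mtNonlin_monotoneOn ha hA hL) (hs0.le.trans h0) h12
    isop := fun s₁ s₂ h0 h12 _ =>
      P.levelMeasure_mul_le (mtNonlin_nonneg_of_le ha hA hL) (hs0.trans_le h0) h12
    growth := fun s₁ s₂ h0 h12 h2 => mtNonlin_growth hA hL hs0' h0 h12 h2 }

/-- The energy of a piece between two levels is at least the energy of a standard bubble. -/
theorem le_levelEnergy_sub (P : IsPiece D v (mtNonlin A L) a) (ha : 0 < a) (hA : 0 ≤ A)
    (hL : 0 < L) {s₀ γ : ℝ} (hs0 : a < s₀) (hγ0 : 0 < γ) (hγ : ∀ y ∈ D, v y ≤ γ) {p : E2}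
    (hp : p ∈ D) {s₁ s₂ : ℝ} (h1 : s₀ ≤ s₁) (h12 : s₁ ≤ s₂) (h2 : s₂ ≤ v p - 2) :
    (s₂ - s₁) * (4 * π * (1 - exp (-(γ + 1 / (2 * s₀)))) / (γ + 1 / (2 * s₀))) ≤
      levelEnergy D v s₁ - levelEnergy D v s₂ := by
  have B := P.isBolProfile ha hA hL hs0 hγ0 hγ
  have hκ := B.kappa_pos
  set κ := γ + 1 / (2 * s₀) with hκdef
  have hvp := hγ p hp
  refine le_trans (mul_le_mul_of_nonneg_left ?_ (sub_nonneg.2 h12))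
    (P.mul_levelMass_le (mtNonlin_nonneg_of_le ha hA hL) (hs0.le.trans h1) h12)
  have hb : 0 < levelMass D v (mtNonlin A L) (v p - 1) := by
    have h3 : s₀ ≤ v p - 1 := by linarith
    have h4 := B.mul_le_F h3 (by linarith)
    have h5 : 0 < levelMeasure D v (v p - 1) := by
      refine ENNReal.toReal_pos ?_ (P.volume_superlevel_lt_top (hs0.le.trans h3)).ne
      refine ((P.isOpen_superlevel _).measure_pos volume ⟨p, hp, by linarith⟩).ne'
    exact (mul_pos (B.G_pos _ h3 (by linarith)) h5).trans_le h4
  have h6 := B.le_F (h1.trans h12) (b := v p - 1) (by linarith) (by linarith) hb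
  rw [div_le_iff₀ hκ, mul_comm (levelMass _ _ _ _)]
  refine le_trans ?_ h6
  gcongr
  nlinarith

end IsPiece

/-- If every line of a parallel family of width `b - a` meets `{u ≥ H}`, then the total variation
of `u` is at least `H (b - a)`. -/
theorem mul_sub_le_integral_norm_fderiv_aux {u : E2 → ℝ} (hu : ContDiff ℝ 1 u)
    (hc : HasCompactSupport u) {Φ : ℝ × ℝ → E2} (hΦm : MeasurePreserving Φ) {e e' : E2}
    (he' : ‖e'‖ = 1) (hΦ : ∀ p, Φ p = p.1 • e + p.2 • e') {a b H : ℝ} (hab : a ≤ b)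
    (h : ∀ t ∈ Set.Ioo a b, ∃ s, H ≤ u (Φ (t, s))) :
    H * (b - a) ≤ ∫ y, ‖fderiv ℝ u y‖ := by
  have hcont : Continuous fun y => ‖fderiv ℝ u y‖ := (hu.continuous_fderiv one_ne_zero).norm
  have hint : Integrable fun y => ‖fderiv ℝ u y‖ := by
    have : HasCompactSupport fun y => ‖fderiv ℝ u y‖ := (hc.fderiv (𝕜 := ℝ)).norm
    exact hcont.integrable_of_hasCompactSupport this
  have hintΦ : Integrable (fun p : ℝ × ℝ => ‖fderiv ℝ u (Φ p)‖) (volume.prod volume) := by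
    have := hΦm.integrable_comp hint.aestronglyMeasurable
    rw [← Measure.volume_eq_prod]
    exact this.2 hint
  have hFub : ∫ y, ‖fderiv ℝ u y‖ = ∫ t : ℝ, ∫ s : ℝ, ‖fderiv ℝ u (Φ (t, s))‖ := by
    rw [← hΦm.map_eq, integral_map hΦm.measurable.aemeasurable
      hcont.aestronglyMeasurable, Measure.volume_eq_prod, integral_prod _ hintΦ]
  have hline : ∀ t ∈ Set.Ioo a b, H ≤ ∫ s : ℝ, ‖fderiv ℝ u (Φ (t, s))‖ := by
    intro t ht
    obtain ⟨s, hs⟩ := h t ht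
    have hiso : Isometry fun s : ℝ => t • e + s • e' := by
      refine Isometry.of_dist_eq fun x y => ?_
      rw [dist_add_left, dist_eq_norm, ← sub_smul, norm_smul, he', mul_one, ← dist_eq_norm]
    have hf1 : ContDiff ℝ 1 fun s : ℝ => u (t • e + s • e') :=
      hu.comp (by fun_prop)
    have hfc : HasCompactSupport fun s : ℝ => u (t • e + s • e') :=
      hc.comp_isClosedEmbedding hiso.isClosedEmbedding
    have hd : ∀ s : ℝ, HasDerivAt (fun s : ℝ => u (t • e + s • e'))
        (fderiv ℝ u (Φ (t, s)) e') s := by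
      intro s
      have h1 : HasDerivAt (fun s : ℝ => t • e + s • e') e' s := by
        simpa using ((hasDerivAt_id s).smul_const e').const_add (t • e)
      rw [hΦ]
      exact (hu.differentiable one_ne_zero _).hasFDerivAt.comp_hasDerivAt s h1
    have hdn : ∀ s : ℝ, ‖deriv (fun s : ℝ => u (t • e + s • e')) s‖ ≤ ‖fderiv ℝ u (Φ (t, s))‖ := by
      intro s
      rw [(hd s).deriv]
      simpa [he'] using (fderiv ℝ u (Φ (t, s))).le_opNorm e'
    have hdc : Continuous (deriv fun s : ℝ => u (t • e + s • e')) := hf1.continuous_deriv le_rfl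
    have hdi : Integrable (deriv fun s : ℝ => u (t • e + s • e')) :=
      hdc.integrable_of_hasCompactSupport hfc.deriv
    have hli : Integrable fun s : ℝ => ‖fderiv ℝ u (Φ (t, s))‖ := by
      have h1 : HasCompactSupport fun s : ℝ => ‖fderiv ℝ u (t • e + s • e')‖ :=
        ((hc.fderiv (𝕜 := ℝ)).norm).comp_isClosedEmbedding hiso.isClosedEmbedding
      have h2 : Continuous fun s : ℝ => ‖fderiv ℝ u (t • e + s • e')‖ :=
        hcont.comp (by fun_prop)
      simp only [hΦ]
      exact h2.integrable_of_hasCompactSupport h1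
    have h3 := HasCompactSupport.integral_Iic_deriv_eq hf1 hfc s
    rw [hΦ] at hs
    calc H ≤ u (t • e + s • e') := hs
      _ = ∫ x in Set.Iic s, deriv (fun s : ℝ => u (t • e + s • e')) x := h3.symm
      _ ≤ ‖∫ x in Set.Iic s, deriv (fun s : ℝ => u (t • e + s • e')) x‖ := le_norm_self _
      _ ≤ ∫ x in Set.Iic s, ‖deriv (fun s : ℝ => u (t • e + s • e')) x‖ :=
        norm_integral_le_integral_norm _
      _ ≤ ∫ x, ‖deriv (fun s : ℝ => u (t • e + s • e')) x‖ :=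
        setIntegral_le_integral hdi.norm (Eventually.of_forall fun _ => norm_nonneg _)
      _ ≤ _ := integral_mono hdi.norm hli hdn
  have hout : Integrable fun t : ℝ => ∫ s : ℝ, ‖fderiv ℝ u (Φ (t, s))‖ :=
    hintΦ.integral_prod_left
  rw [hFub]
  calc H * (b - a) = ∫ _ in Set.Ioo a b, H := by
        rw [setIntegral_const, smul_eq_mul, mul_comm, Measure.real, Real.volume_Ioo,
          ENNReal.toReal_ofReal (by linarith)]
    _ ≤ ∫ t in Set.Ioo a b, ∫ s : ℝ, ‖fderiv ℝ u (Φ (t, s))‖ :=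
        setIntegral_mono_on (integrableOn_const (by simp)) hout.integrableOn
          measurableSet_Ioo hline
    _ ≤ _ := setIntegral_le_integral hout
        (Eventually.of_forall fun _ => integral_nonneg fun _ => norm_nonneg _)

theorem mul_sub_le_integral_norm_fderiv {u : E2 → ℝ} (hu : ContDiff ℝ 1 u)
    (hc : HasCompactSupport u) (i : Fin 2) {a b H : ℝ} (hab : a ≤ b)
    (h : ∀ t ∈ Set.Ioo a b, ∃ p : E2, p i = t ∧ H ≤ u p) :
    H * (b - a) ≤ ∫ y, ‖fderiv ℝ u y‖ := by
  fin_cases i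
  · refine mul_sub_le_integral_norm_fderiv_aux hu hc measurePreserving_planeOfProd
      (e := EuclideanSpace.single 0 1) (e' := EuclideanSpace.single 1 1) (by simp) ?_ hab ?_
    · intro p
      ext j
      fin_cases j <;> simp [planeOfProd]
    · intro t ht
      obtain ⟨p, hp, hup⟩ := h t ht
      refine ⟨p 1, ?_⟩
      have : planeOfProd (t, p 1) = p := by
        ext j
        fin_cases j
        · simpa [planeOfProd] using hp.symm
        · simp [planeOfProd]
      rwa [this]
  · refine mul_sub_le_integral_norm_fderiv_aux hu hc
      (Φ := planeOfProd ∘ Prod.swap) (measurePreserving_planeOfProd.comp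
        (Measure.measurePreserving_swap (μ := volume) (ν := volume)))
      (e := EuclideanSpace.single 1 1) (e' := EuclideanSpace.single 0 1) (by simp) ?_ hab ?_
    · intro p
      ext j
      fin_cases j <;> simp [planeOfProd]
    · intro t ht
      obtain ⟨p, hp, hup⟩ := h t ht
      refine ⟨p 0, ?_⟩
      have : (planeOfProd ∘ Prod.swap) (t, p 0) = p := by
        ext j
        fin_cases j
        · simp [planeOfProd]
        · simpa [planeOfProd] using hp.symm
      rwa [this]

namespace IsPiece

variable {D : Set E2} {v : E2 → ℝ} {G : ℝ → ℝ} {a : ℝ}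

/-- If all lines of a strip of width `w` meet `{v ≥ c}`, then the energy between levels bounds the
width of the strip. -/
theorem sq_mul_sq_le (P : IsPiece D v G a) (i : Fin 2) {c t₁ t₂ : ℝ} (hc : a + 1 ≤ c)
    (ht : t₁ ≤ t₂) (h : ∀ t ∈ Set.Ioo t₁ t₂, ∃ p ∈ D, p i = t ∧ c ≤ v p) :
    ((c - a - 1) * (t₂ - t₁)) ^ 2 ≤ levelMeasure D v a * levelEnergy D v a := by
  obtain ⟨hu1, huc⟩ := P.contDiff_indicator (contDiff_ramp a 1) fun t ht =>
    ramp_of_le one_pos ht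
  set u : E2 → ℝ := D.indicator fun y => ramp a 1 (v y) with hu
  have h1 := mul_sub_le_integral_norm_fderiv hu1 huc i (H := c - a - 1) ht fun t ht => by
    obtain ⟨p, hp, hpt, hcp⟩ := h t ht
    refine ⟨p, hpt, ?_⟩
    rw [hu, Set.indicator_of_mem hp, ramp_of_ge one_pos (by linarith)]
    linarith
  have hgc : ContinuousOn (fun y => ‖gradient v y‖) D := by
    simp only [norm_gradient_eq]
    exact P.continuousOn_norm_fderiv
  have hgi := P.integrableOn_of_continuousOn hgc le_rfl
  have hms := (P.isOpen_superlevel a).measurableSet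
  have hz : ∀ y ∈ D, ‖fderiv ℝ u y‖ ≤ ‖rampDeriv a 1 (v y)‖ * ‖gradient v y‖ := fun y hy => by
    rw [hu, P.fderiv_indicator hy (hasDerivAt_ramp a 1 (v y)), norm_smul, norm_gradient_eq]
  have h2 : ∫ y, ‖fderiv ℝ u y‖ ≤ ∫ y in superlevel D v a, ‖gradient v y‖ := by
    have hzero : ∀ y ∉ superlevel D v a, ‖fderiv ℝ u y‖ = 0 := by
      intro y hy
      by_cases hD : y ∈ D
      · have hva : v y ≤ a := by by_contra h'; exact hy ⟨hD, not_le.1 h'⟩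
        have := hz y hD
        rw [rampDeriv_of_le one_pos hva, norm_zero, zero_mul] at this
        exact le_antisymm this (norm_nonneg _)
      · have hu0 : ∀ y ∉ {y | y ∈ D ∧ a ≤ v y}, u y = 0 := by
          intro y hy
          by_cases hD : y ∈ D
          · rw [hu, Set.indicator_of_mem hD]
            exact ramp_of_le one_pos (by by_contra h'; exact hy ⟨hD, (not_le.1 h').le⟩)
          · rw [hu, Set.indicator_of_notMem hD]
        have : y ∉ tsupport u := fun h' => hD (P.tsupport_subset hu0 h').1
        rw [fderiv_of_notMem_tsupport ℝ this, norm_zero]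
    rw [← setIntegral_eq_integral_of_forall_compl_eq_zero hzero]
    refine setIntegral_mono_on ?_ hgi hms fun y hy => ?_
    · have : HasCompactSupport fun y => ‖fderiv ℝ u y‖ := (huc.fderiv (𝕜 := ℝ)).norm
      exact ((hu1.continuous_fderiv one_ne_zero).norm.integrable_of_hasCompactSupport
        this).integrableOn
    · exact (hz y hy.1).trans (mul_le_of_le_one_left (norm_nonneg _)
        (by simpa using abs_rampDeriv_le_one one_pos (v y)))
  have h3 := sq_setIntegral_le (P.volume_superlevel_lt_top le_rfl).ne hgi
    (P.integrableOn_of_continuousOn P.continuousOn_gradient_norm_sq le_rfl)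
  have h4 : 0 ≤ (c - a - 1) * (t₂ - t₁) := mul_nonneg (by linarith) (by linarith)
  exact (pow_le_pow_left₀ h4 (h1.trans h2) 2).trans h3

end IsPiece

/-- Exponential decay from a discrete differential inequality. -/
theorem le_mul_exp_of_mul_le_sub {m : ℝ → ℝ} {a b k : ℝ} (hk : 0 ≤ k) (hab : a ≤ b)
    (hm0 : ∀ s, 0 ≤ m s) (hm : ∀ s, a ≤ s → s ≤ b → m s ≤ m a)
    (h : ∀ s₁ s₂, a ≤ s₁ → s₁ ≤ s₂ → s₂ ≤ b → k * m s₂ * (s₂ - s₁) ≤ m s₁ - m s₂) :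
    m b ≤ m a * exp (-(k * (b - a))) := by
  set C : ℝ := exp (k * (b - a)) * (k ^ 2 * exp (k * (b - a))) * m a with hC
  have key := le_of_forall_le_add_mul_sub (h := fun t => exp (k * (t - a)) * m t)
    (Q := fun t => -(C * t)) hab ?_
  · simp only [sub_self, mul_zero, exp_zero, one_mul] at key
    have h1 := mul_le_mul_of_nonneg_right key (exp_pos (-(k * (b - a)))).le
    have h2 : exp (k * (b - a)) * exp (-(k * (b - a))) = 1 := by rw [← exp_add]; simp
    calc m b = exp (k * (b - a)) * m b * exp (-(k * (b - a))) := by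
          rw [mul_right_comm, h2, one_mul]
      _ ≤ _ := h1
  intro s₁ s₂ h1 h12 h2
  have h3 := h s₁ s₂ h1 h12 h2
  have hm2 := hm0 s₂
  have hma := hm s₂ (h1.trans h12) h2
  set η := s₂ - s₁ with hη
  have hη0 : 0 ≤ η := sub_nonneg.2 h12
  have e1 : exp (k * (s₂ - a)) = exp (k * (s₁ - a)) * exp (k * η) := by
    rw [← exp_add, hη]; congr 1; ring
  have e2 : η * (-(C * s₁) - -(C * s₂)) = C * η ^ 2 := by rw [hη]; ring
  have e3 : exp (k * (s₁ - a)) ≤ exp (k * (b - a)) := by gcongr; linarith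
  have e4 : exp (k * η) ≤ exp (k * (b - a)) := by gcongr; rw [hη]; linarith
  have e5 : exp (k * η) ≤ 1 + k * η + k ^ 2 * η ^ 2 * exp (k * (b - a)) := by
    have e0 : 0 ≤ k * η := by positivity
    have e6 : exp (k * η) - 1 ≤ k * η * exp (k * η) := by
      have := add_one_le_exp (-(k * η))
      have h3 : exp (-(k * η)) * exp (k * η) = 1 := by rw [← exp_add]; simp
      nlinarith [exp_pos (k * η)]
    nlinarith [mul_le_mul_of_nonneg_left e4 (mul_nonneg e0 e0),
      mul_le_mul_of_nonneg_left e6 e0]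
  rw [e2, e1]
  have h4 : exp (k * η) * m s₂ ≤ m s₁ + k ^ 2 * η ^ 2 * exp (k * (b - a)) * m a := by
    have h5 := mul_le_mul_of_nonneg_right e5 hm2
    have h6 : k ^ 2 * η ^ 2 * exp (k * (b - a)) * m s₂ ≤
        k ^ 2 * η ^ 2 * exp (k * (b - a)) * m a := by gcongr
    linarith
  have hma0 := hm0 a
  calc exp (k * (s₁ - a)) * exp (k * η) * m s₂
      = exp (k * (s₁ - a)) * (exp (k * η) * m s₂) := by ring
    _ ≤ exp (k * (s₁ - a)) * (m s₁ + k ^ 2 * η ^ 2 * exp (k * (b - a)) * m a) := by gcongr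
    _ = exp (k * (s₁ - a)) * m s₁ +
        exp (k * (s₁ - a)) * (k ^ 2 * η ^ 2 * exp (k * (b - a)) * m a) := by ring
    _ ≤ exp (k * (s₁ - a)) * m s₁ +
        exp (k * (b - a)) * (k ^ 2 * η ^ 2 * exp (k * (b - a)) * m a) := by gcongr
    _ = exp (k * (s₁ - a)) * m s₁ + C * η ^ 2 := by rw [hC]; ring

theorem IsPiece.levelMeasure_le_exp {D : Set E2} {v : E2 → ℝ} {G : ℝ → ℝ} {a : ℝ}
    (P : IsPiece D v G a) (hG : ∀ t, a ≤ t → 0 ≤ G t) (hGm : MonotoneOn G (Set.Ici a))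
    {s b k : ℝ} (hk : 0 ≤ k) (hs : a < s) (hsb : s ≤ b) (hF : k * levelMass D v G s ≤ 4 * π) :
    levelMeasure D v b ≤ levelMeasure D v s * exp (-(k * (b - s))) := by
  refine le_mul_exp_of_mul_le_sub hk hsb (fun _ => measureReal_nonneg)
    (fun t hst _ => P.levelMeasure_anti hs.le hst) fun s₁ s₂ h1 h12 _ => ?_
  have h3 := P.levelMeasure_mul_le hG (hs.trans_le h1) h12
  have h4 := P.levelMeasure_anti (hs.le.trans h1) h12
  have h5 := P.levelMeasure_anti hs.le h1
  have h6 := P.mul_levelMeasure_sub_le hGm hs.le h1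
  have h7 : levelMass D v G s₁ ≤ levelMass D v G s := by
    have := mul_nonneg (hG s hs.le) (sub_nonneg.2 h5)
    linarith
  have h8 : k * (4 * π * levelMeasure D v s₂ * (s₂ - s₁)) ≤
      4 * π * (levelMeasure D v s₁ - levelMeasure D v s₂) := by
    calc k * (4 * π * levelMeasure D v s₂ * (s₂ - s₁))
        ≤ k * (levelMass D v G s₁ * (levelMeasure D v s₁ - levelMeasure D v s₂)) := by gcongr
      _ ≤ k * (levelMass D v G s * (levelMeasure D v s₁ - levelMeasure D v s₂)) := by
        gcongr
      _ = (k * levelMass D v G s) * (levelMeasure D v s₁ - levelMeasure D v s₂) := by ring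
      _ ≤ _ := by gcongr
  have h9 : (0 : ℝ) < 4 * π := by positivity
  refine le_of_mul_le_mul_left ?_ h9
  linarith

/-- The standing assumptions on a blowing-up sequence with energy tending to `4π`. -/
structure IsBlowUp (Ω : Set E2) (v : ℕ → E2 → ℝ) (A L : ℕ → ℝ) (x : ℕ → E2) : Prop where
  isOpen : IsOpen Ω
  isBounded : IsBounded Ω
  A_nonneg : ∀ n, 0 ≤ A n
  L_pos : ∀ n, 0 < L n
  smooth : ∀ n, ContDiffOn ℝ (⊤ : ℕ∞) (v n) Ω
  continuousOn : ∀ n, ContinuousOn (v n) (closure Ω)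
  pos : ∀ n, ∀ y ∈ Ω, 0 < v n y
  pde : ∀ n, ∀ y ∈ Ω, lapl (v n) y = mtNonlin (A n) (L n) (v n y)
  boundary : ∀ n, ∀ y ∈ frontier Ω, v n y = 0
  integrable : ∀ n, IntegrableOn (fun y => ‖gradient (v n) y‖ ^ 2) Ω
  energy : Tendsto (fun n => ∫ y in Ω, ‖gradient (v n) y‖ ^ 2) atTop (𝓝 (4 * π))
  L_lim : Tendsto L atTop (𝓝 0)
  mem : ∀ n, x n ∈ Ω
  le_max : ∀ n, ∀ y ∈ Ω, v n y ≤ v n (x n)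
  max_lim : Tendsto (fun n => v n (x n)) atTop atTop

theorem tendsto_bubble_const {c : ℝ} :
    Tendsto (fun g : ℝ => g * (4 * π * (1 - exp (-(g + 1 / (2 * (c * g))))) /
      (g + 1 / (2 * (c * g))))) atTop (𝓝 (4 * π)) := by
  have hinv : Tendsto (fun g : ℝ => g⁻¹) atTop (𝓝 0) := tendsto_inv_atTop_zero
  have h1 : Tendsto (fun g : ℝ => 1 / (2 * (c * g))) atTop (𝓝 0) := by
    have := hinv.const_mul (1 / (2 * c))
    simp only [mul_zero] at this
    refine this.congr fun g => ?_
    rw [one_div, one_div, mul_inv, mul_inv, mul_inv, mul_assoc]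
  have h2 : Tendsto (fun g : ℝ => g + 1 / (2 * (c * g))) atTop atTop :=
    tendsto_id.atTop_add h1
  have h3 : Tendsto (fun g : ℝ => exp (-(g + 1 / (2 * (c * g))))) atTop (𝓝 0) :=
    tendsto_exp_neg_atTop_nhds_zero.comp h2
  have h4 : Tendsto (fun g : ℝ => 1 + 1 / (2 * (c * g)) * g⁻¹) atTop (𝓝 (1 + 0 * 0)) :=
    tendsto_const_nhds.add (h1.mul hinv)
  have h5 : Tendsto (fun g : ℝ => 4 * π * (1 - exp (-(g + 1 / (2 * (c * g))))) /
      (1 + 1 / (2 * (c * g)) * g⁻¹)) atTop (𝓝 (4 * π * (1 - 0) / (1 + 0 * 0))) :=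
    (((tendsto_const_nhds.sub h3).const_mul (4 * π))).div h4 (by norm_num)
  simp only [sub_zero, mul_zero, add_zero, div_one, mul_one] at h5
  refine h5.congr' ?_
  filter_upwards [eventually_gt_atTop 0] with g hg
  have e : g + 1 / (2 * (c * g)) = g * (1 + 1 / (2 * (c * g)) * g⁻¹) := by
    field_simp
  have key : ∀ X Y : ℝ, X / Y = g * (X / (g * Y)) := fun X Y => by
    rw [mul_div_assoc', mul_div_mul_left _ _ hg.ne']
  rw [key, ← e]

namespace IsBlowUp

variable {Ω : Set E2} {v : ℕ → E2 → ℝ} {A L : ℕ → ℝ} {x : ℕ → E2}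

theorem isPiece (B : IsBlowUp Ω v A L x) {n : ℕ} {D : Set E2} (hD : IsOpen D) (hDΩ : D ⊆ Ω)
    {a : ℝ} (ha : 0 < a) (h : ∀ y ∈ Ω, y ∈ closure D → y ∉ D → v n y < a) :
    IsPiece D (v n) (mtNonlin (A n) (L n)) a where
  isOpen := hD
  smooth := (B.smooth n).mono hDΩ
  isCompact := by
    have hcD : closure D ⊆ closure Ω := closure_mono hDΩ
    have hc : IsCompact (closure D) := (B.isBounded.subset hDΩ).isCompact_closure
    obtain ⟨C, hC, hCD⟩ := (continuousOn_iff_isClosed.1 ((B.continuousOn n).mono hcD))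
      (Set.Ici a) isClosed_Ici
    have e : {y | y ∈ D ∧ a ≤ v n y} = closure D ∩ C := by
      rw [Set.inter_comm, ← hCD]
      ext y
      constructor
      · exact fun hy => ⟨hy.2, subset_closure hy.1⟩
      · rintro ⟨hy1, hy2⟩
        have hy1' : a ≤ v n y := hy1
        refine ⟨?_, hy1⟩
        by_contra hyD
        by_cases hyΩ : y ∈ Ω
        · exact (h y hyΩ hy2 hyD).not_ge hy1
        · have : y ∈ frontier Ω := by
            rw [B.isOpen.frontier_eq]
            exact ⟨hcD hy2, hyΩ⟩
          rw [B.boundary n y this] at hy1'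
          linarith
    rw [e]
    exact hc.inter_right hC
  pde := fun y hy => B.pde n y (hDΩ hy)
  continuous_G := continuous_mtNonlin _ _

theorem isPiece_self (B : IsBlowUp Ω v A L x) (n : ℕ) {a : ℝ} (ha : 0 < a) :
    IsPiece Ω (v n) (mtNonlin (A n) (L n)) a :=
  B.isPiece B.isOpen subset_rfl ha fun _ hy _ h => absurd hy h

theorem eventually_pos (B : IsBlowUp Ω v A L x) : ∀ᶠ n in atTop, 0 < v n (x n) :=
  B.max_lim.eventually_gt_atTop 0

theorem levelEnergy_nonneg (D : Set E2) (f : E2 → ℝ) (s : ℝ) : 0 ≤ levelEnergy D f s :=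
  integral_nonneg fun _ => sq_nonneg _

theorem energy_sub_levelEnergy (B : IsBlowUp Ω v A L x) {n : ℕ} {D : Set E2} (hDΩ : D ⊆ Ω)
    {a : ℝ} (P : IsPiece D (v n) (mtNonlin (A n) (L n)) a) (s : ℝ) :
    (∫ y in Ω, ‖gradient (v n) y‖ ^ 2) - levelEnergy D (v n) s =
      ∫ y in Ω \ superlevel D (v n) s, ‖gradient (v n) y‖ ^ 2 :=
  (setIntegral_sdiff (P.isOpen_superlevel s).measurableSet (B.integrable n)
    (fun _ hy => hDΩ hy.1)).symm

theorem levelEnergy_le (B : IsBlowUp Ω v A L x) {n : ℕ} {D : Set E2} (hDΩ : D ⊆ Ω)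
    {a : ℝ} (P : IsPiece D (v n) (mtNonlin (A n) (L n)) a) (s : ℝ) :
    levelEnergy D (v n) s ≤ ∫ y in Ω, ‖gradient (v n) y‖ ^ 2 := by
  have h1 := B.energy_sub_levelEnergy hDΩ P s
  have h2 : 0 ≤ ∫ y in Ω \ superlevel D (v n) s, ‖gradient (v n) y‖ ^ 2 :=
    integral_nonneg fun _ => sq_nonneg _
  linarith

theorem levelMeasure_le (B : IsBlowUp Ω v A L x) (n : ℕ) (s : ℝ) :
    levelMeasure Ω (v n) s ≤ volume.real Ω :=
  measureReal_mono (fun _ hy => hy.1) B.isBounded.measure_lt_top.ne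

/-- Every piece on which `v` reaches the height `c₁ γ` carries at least the energy of a bubble
between the heights `c₀ γ` and `c₁ γ`. -/
theorem eventually_le_levelEnergy_sub (B : IsBlowUp Ω v A L x) {c₀ c₁ η : ℝ}
    (h01 : c₀ < c₁) (hη : 0 < η) :
    ∀ᶠ n in atTop, ∀ D ⊆ Ω, ∀ a, 0 < a → a < c₀ * v n (x n) →
      IsPiece D (v n) (mtNonlin (A n) (L n)) a → ∀ p ∈ D, c₁ * v n (x n) ≤ v n p →
      4 * π * (c₁ - c₀ - η) ≤
        levelEnergy D (v n) (c₀ * v n (x n)) - levelEnergy D (v n) (c₁ * v n (x n)) := by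
  have hlim : Tendsto (fun g : ℝ => (c₁ - c₀ - 2 * g⁻¹) *
      (g * (4 * π * (1 - exp (-(g + 1 / (2 * (c₀ * g))))) / (g + 1 / (2 * (c₀ * g))))))
      atTop (𝓝 ((c₁ - c₀ - 2 * 0) * (4 * π))) :=
    (tendsto_const_nhds.sub (tendsto_inv_atTop_zero.const_mul 2)).mul tendsto_bubble_const
  have hev := (hlim.comp B.max_lim).eventually (lt_mem_nhds (a := 4 * π * (c₁ - c₀ - η))
    (by nlinarith [pi_pos]))
  filter_upwards [hev, B.eventually_pos,
    B.max_lim.eventually_ge_atTop (2 / (c₁ - c₀))] with n hn hγ hγ2 D hDΩ a ha hac P p hp hcp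
  set γ := v n (x n) with hγdef
  have hlow : c₀ * γ ≤ c₁ * γ - 2 := by
    rw [div_le_iff₀ (sub_pos.2 h01)] at hγ2
    linarith
  have h1 := P.le_levelEnergy_sub ha (B.A_nonneg n) (B.L_pos n) hac hγ
    (fun y hy => B.le_max n y (hDΩ hy)) hp le_rfl hlow (by linarith)
  have h2 := P.levelEnergy_anti (hac.le.trans hlow) (by linarith : c₁ * γ - 2 ≤ c₁ * γ)
  simp only [Function.comp_apply] at hn
  rw [← mul_assoc] at hn
  have e : (c₁ - c₀ - 2 * γ⁻¹) * γ = c₁ * γ - 2 - c₀ * γ := by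
    field_simp
    ring
  rw [e] at hn
  linarith

theorem eventually_energy_le (B : IsBlowUp Ω v A L x) {η : ℝ} (hη : 0 < η) :
    ∀ᶠ n in atTop, (∫ y in Ω, ‖gradient (v n) y‖ ^ 2) ≤ 4 * π * (1 + η) := by
  have hlt : 4 * π < 4 * π * (1 + η) := by nlinarith [pi_pos]
  filter_upwards [B.energy.eventually (gt_mem_nhds hlt)] with n hn using hn.le

/-- A piece containing the maximum point leaves little energy outside its superlevel sets. -/
theorem eventually_energy_sub_le (B : IsBlowUp Ω v A L x) {c₀ η : ℝ} (h01 : c₀ < 1)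
    (hη : 0 < η) :
    ∀ᶠ n in atTop, ∀ D ⊆ Ω, ∀ a, 0 < a → a < c₀ * v n (x n) →
      IsPiece D (v n) (mtNonlin (A n) (L n)) a → x n ∈ D →
      (∫ y in Ω, ‖gradient (v n) y‖ ^ 2) - levelEnergy D (v n) (c₀ * v n (x n)) ≤
        4 * π * (c₀ + η) := by
  filter_upwards [B.eventually_le_levelEnergy_sub h01 (half_pos hη),
    B.eventually_energy_le (half_pos hη)] with n h1 h2 D hDΩ a ha hac P hx
  have h3 := h1 D hDΩ a ha hac P _ hx (by rw [one_mul])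
  have h4 := levelEnergy_nonneg D (v n) (1 * v n (x n))
  linarith

theorem eventually_energy_sub_le_self (B : IsBlowUp Ω v A L x) {c₀ η : ℝ} (h0 : 0 < c₀)
    (h01 : c₀ < 1) (hη : 0 < η) :
    ∀ᶠ n in atTop, (∫ y in Ω, ‖gradient (v n) y‖ ^ 2) -
      levelEnergy Ω (v n) (c₀ * v n (x n)) ≤ 4 * π * (c₀ + η) := by
  filter_upwards [B.eventually_energy_sub_le h01 hη, B.eventually_pos] with n h1 hγ
  have h2 : 0 < c₀ * v n (x n) / 2 := by positivity
  exact h1 Ω subset_rfl _ h2 (by linarith) (B.isPiece_self n h2) (B.mem n)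

theorem mtNonlin_nonneg (B : IsBlowUp Ω v A L x) (n : ℕ) {a : ℝ} (ha : 0 < a) :
    ∀ t, a ≤ t → 0 ≤ mtNonlin (A n) (L n) t :=
  IsPiece.mtNonlin_nonneg_of_le ha (B.A_nonneg n) (B.L_pos n)

theorem mtNonlin_monotoneOn (B : IsBlowUp Ω v A L x) (n : ℕ) {a : ℝ} (ha : 0 < a) :
    MonotoneOn (mtNonlin (A n) (L n)) (Set.Ici a) :=
  IsPiece.mtNonlin_monotoneOn ha (B.A_nonneg n) (B.L_pos n)

theorem eventually_mul_levelMass_le (B : IsBlowUp Ω v A L x) {c η : ℝ} (h0 : 0 < c)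
    (h1 : c < 1) (hη : 0 < η) :
    ∀ᶠ n in atTop, v n (x n) * levelMass Ω (v n) (mtNonlin (A n) (L n)) (c * v n (x n)) ≤
      4 * π * (1 + η) := by
  set ε := c * η / (2 + η) with hε
  have hε0 : 0 < ε := by positivity
  have hεη : ε * (2 + η) = c * η := by rw [hε]; field_simp
  have hεc : ε < c := by nlinarith
  filter_upwards [B.eventually_energy_sub_le_self h0 h1 hε0, B.eventually_pos] with n h2 hγ
  set γ := v n (x n) with hγdef
  have ha : 0 < ε * γ := by positivity
  have P := B.isPiece_self n ha
  have h3 := P.mul_levelMass_le (B.mtNonlin_nonneg n ha) le_rfl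
    (mul_le_mul_of_nonneg_right hεc.le hγ.le)
  have h4 := B.levelEnergy_le subset_rfl P (ε * γ)
  have h5 : (c - ε) * (γ * levelMass Ω (v n) (mtNonlin (A n) (L n)) (c * γ)) ≤
      (c - ε) * (4 * π * (1 + η)) := by
    have e : (c - ε) * (4 * π * (1 + η)) = 4 * π * (c + ε) := by
      have : (c - ε) * (1 + η) = c + ε := by linarith
      rw [mul_left_comm, this]
    rw [e]
    linarith
  exact le_of_mul_le_mul_left h5 (sub_pos.2 hεc)

/-- Decay of the distribution function. -/
theorem eventually_levelMeasure_le (B : IsBlowUp Ω v A L x) {c θ : ℝ} (hθ : 0 < θ)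
    (hθc : θ < c) (hc : c < 1) :
    ∀ᶠ n in atTop, levelMeasure Ω (v n) (c * v n (x n)) ≤
      volume.real Ω * exp (-(θ * v n (x n) ^ 2)) := by
  set c' := (c - θ) / 2 with hc'
  set η := (c - θ) / (2 * θ) with hηdef
  have hη : 0 < η := div_pos (by linarith) (by linarith)
  have hηθ : η * θ = (c - θ) / 2 := by rw [hηdef]; field_simp
  have hc'0 : 0 < c' := by rw [hc']; linarith
  have hcc' : c' < c := by rw [hc']; linarith
  filter_upwards [B.eventually_mul_levelMass_le hc'0 (by linarith) hη, B.eventually_pos]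
    with n h2 hγ
  set γ := v n (x n) with hγdef
  have ha : 0 < c' * γ / 2 := by positivity
  have P := B.isPiece_self n ha
  have h3 := P.levelMeasure_le_exp (B.mtNonlin_nonneg n ha) (B.mtNonlin_monotoneOn n ha)
    (s := c' * γ) (b := c * γ) (k := γ / (1 + η)) (by positivity) (by linarith)
    (mul_le_mul_of_nonneg_right hcc'.le hγ.le)
    (by rw [div_mul_eq_mul_div, div_le_iff₀ (by positivity)]; exact h2)
  refine h3.trans ?_
  have e : γ / (1 + η) * (c * γ - c' * γ) = θ * γ ^ 2 := by
    have : (c - c') = θ * (1 + η) := by rw [hc']; linarith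
    rw [← sub_mul, this]
    field_simp
  rw [e]
  gcongr
  exact B.levelMeasure_le n _

end IsBlowUp

theorem exists_half_le_abs_sub {p q : E2} {r : ℝ} (h : dist p q = r) :
    ∃ i : Fin 2, r / 2 ≤ |p i - q i| := by
  by_contra! hlt
  have h1 : dist p q ^ 2 = (p 0 - q 0) ^ 2 + (p 1 - q 1) ^ 2 := by
    rw [EuclideanSpace.dist_eq, Real.sq_sqrt (Finset.sum_nonneg fun i _ => sq_nonneg _)]
    simp [Fin.sum_univ_two, Real.dist_eq, sq_abs]
  have h2 : ∀ i : Fin 2, (p i - q i) ^ 2 < (r / 2) ^ 2 := fun i => by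
    rw [← sq_abs]
    exact pow_lt_pow_left₀ (hlt i) (abs_nonneg _) two_ne_zero
  have h3 := h2 0
  have h4 := h2 1
  rw [h] at h1
  nlinarith

/-- The level energy is additive when `v` is low on a separating line. -/
theorem IsPiece.levelEnergy_eq_add {D : Set E2} {v : E2 → ℝ} {G : ℝ → ℝ} {a : ℝ}
    (P : IsPiece D v G a) {i : Fin 2} {t s : ℝ} (hs : a ≤ s)
    (h : ∀ p ∈ D, p i = t → v p ≤ s) :
    levelEnergy D v s =
      levelEnergy (D ∩ {p | p i < t}) v s + levelEnergy (D ∩ {p | t < p i}) v s := by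
  have hci : Continuous fun p : E2 => p i := by fun_prop
  have e : superlevel D v s =
      superlevel (D ∩ {p | p i < t}) v s ∪ superlevel (D ∩ {p | t < p i}) v s := by
    ext p
    constructor
    · rintro ⟨hp, hsp⟩
      rcases lt_trichotomy (p i) t with hpt | hpt | hpt
      · exact Or.inl ⟨⟨hp, hpt⟩, hsp⟩
      · exact absurd (h p hp hpt) hsp.not_ge
      · exact Or.inr ⟨⟨hp, hpt⟩, hsp⟩
    · rintro (hp | hp) <;> exact ⟨hp.1.1, hp.2⟩
  have hint := P.integrableOn_of_continuousOn P.continuousOn_gradient_norm_sq hs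
  have hm : MeasurableSet (superlevel (D ∩ {p | t < p i}) v s) := by
    have : superlevel (D ∩ {p | t < p i}) v s = superlevel D v s ∩ {p | t < p i} := by
      ext p
      exact ⟨fun hp => ⟨⟨hp.1.1, hp.2⟩, hp.1.2⟩, fun hp => ⟨⟨hp.1.1, hp.2⟩, hp.1.2⟩⟩
    rw [this]
    exact ((P.isOpen_superlevel s).inter (isOpen_lt continuous_const hci)).measurableSet
  unfold levelEnergy
  rw [e] at hint ⊢
  refine setIntegral_union ?_ hm hint.left_of_union hint.right_of_union
  rw [Set.disjoint_left]
  intro p hp hp'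
  exact lt_asymm (show p i < t from hp.1.2) hp'.1.2

namespace IsBlowUp

variable {Ω : Set E2} {v : ℕ → E2 → ℝ} {A L : ℕ → ℝ} {x : ℕ → E2}

theorem eventually_le_radius_sq (B : IsBlowUp Ω v A L x) {μ r : ℕ → ℝ} {δ : ℝ}
    (hμ : ∀ n, 0 < μ n ∧
      ((μ n)⁻¹) ^ 2 = L n / 4 * (v n (x n)) ^ 2 * Real.exp ((v n (x n)) ^ 2))
    (hr : ∀ n, 0 < r n ∧ Real.log (1 + (r n) ^ 2 / (μ n) ^ 2) = δ * (v n (x n)) ^ 2) :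
    ∀ᶠ n in atTop, 4 * (exp (δ * v n (x n) ^ 2) - 1) ≤
      r n ^ 2 * v n (x n) ^ 2 * exp (v n (x n) ^ 2) := by
  filter_upwards [B.L_lim.eventually (gt_mem_nhds one_pos)] with n hn
  obtain ⟨hμ0, hμ1⟩ := hμ n
  obtain ⟨hr0, hr1⟩ := hr n
  have h1 : exp (δ * v n (x n) ^ 2) = 1 + r n ^ 2 / μ n ^ 2 := by
    rw [← hr1, exp_log (by positivity)]
  have h2 : r n ^ 2 / μ n ^ 2 = r n ^ 2 * (μ n)⁻¹ ^ 2 := by rw [inv_pow, div_eq_mul_inv]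
  rw [h1, h2, hμ1]
  have h3 : L n * (r n ^ 2 * v n (x n) ^ 2 * exp (v n (x n) ^ 2)) ≤
      1 * (r n ^ 2 * v n (x n) ^ 2 * exp (v n (x n) ^ 2)) := by gcongr
  linarith

/-- Lines on which `v` stays below `c γ` occur at every scale comparable to `r`. -/
theorem eventually_exists_separating (B : IsBlowUp Ω v A L x) {r : ℕ → ℝ} {δ c : ℝ}
    (hr0 : ∀ n, 0 < r n)
    (hr : ∀ᶠ n in atTop, 4 * (exp (δ * v n (x n) ^ 2) - 1) ≤
      r n ^ 2 * v n (x n) ^ 2 * exp (v n (x n) ^ 2))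
    (hδ1 : δ < 1) (hc : 1 - δ < c) (hc1 : c < 1) :
    ∀ᶠ n in atTop, ∀ (i : Fin 2) (t₁ t₂ : ℝ), r n / 2 ≤ t₂ - t₁ →
      ∃ t ∈ Set.Ioo t₁ t₂, ∀ p ∈ Ω, p i = t → v n p < c * v n (x n) := by
  set d := (c - (1 - δ)) / 3 with hd
  have hd0 : 0 < d := by rw [hd]; linarith
  have hθ : 0 < 1 - δ + d := by linarith
  have hc' : 1 - δ + d < c - d := by rw [hd]; linarith
  have hlim : Tendsto (fun n => v n (x n) ^ 2) atTop atTop :=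
    (tendsto_pow_atTop two_ne_zero).comp B.max_lim
  filter_upwards [hr, B.eventually_levelMeasure_le hθ hc' (by linarith),
    B.eventually_energy_le one_pos, B.max_lim.eventually_ge_atTop (2 / d), B.eventually_pos,
    hlim.eventually_gt_atTop (32 * π * volume.real Ω / d ^ 3)]
    with n hrn hmn hEn hγd hγ hγ2 i t₁ t₂ ht
  by_contra! hcon
  set γ := v n (x n) with hγdef
  rw [div_le_iff₀ hd0] at hγd
  rw [div_lt_iff₀ (by positivity)] at hγ2
  have ha : 0 < (c - d) * γ := mul_pos (by linarith) hγ
  have P := B.isPiece_self n ha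
  have hrn0 := hr0 n
  have h1 := P.sq_mul_sq_le i (c := c * γ) (by nlinarith) (by linarith) hcon
  have h2 : levelMeasure Ω (v n) ((c - d) * γ) * levelEnergy Ω (v n) ((c - d) * γ) ≤
      volume.real Ω * exp (-((1 - δ + d) * γ ^ 2)) * (4 * π * (1 + 1)) :=
    mul_le_mul hmn ((B.levelEnergy_le subset_rfl P _).trans hEn) (levelEnergy_nonneg _ _ _)
      (by positivity)
  have h3 : (d * γ / 2 * (r n / 2)) ^ 2 ≤ ((c * γ - (c - d) * γ - 1) * (t₂ - t₁)) ^ 2 := by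
    have : d * γ / 2 ≤ c * γ - (c - d) * γ - 1 := by linarith
    gcongr
    linarith
  have h4 : d ^ 2 * (r n ^ 2 * γ ^ 2) ≤
      128 * π * volume.real Ω * exp (-((1 - δ + d) * γ ^ 2)) := by
    linarith [h3.trans (h1.trans h2)]
  set X := exp ((δ - d) * γ ^ 2) with hX
  have hX1 : 1 ≤ X := by
    refine one_le_exp ?_
    have : 0 < δ - d := by rw [hd]; linarith
    positivity
  have h5 := mul_le_mul_of_nonneg_right h4 (exp_pos (γ ^ 2)).le
  have e1 : exp (-((1 - δ + d) * γ ^ 2)) * exp (γ ^ 2) = X := by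
    rw [← exp_add, hX]; congr 1; ring
  have e2 : exp (δ * γ ^ 2) = X * exp (d * γ ^ 2) := by
    rw [hX, ← exp_add]; congr 1; ring
  rw [mul_assoc _ (exp _), e1] at h5
  have h6 : d ^ 2 * (4 * (X * exp (d * γ ^ 2) - 1)) ≤ 128 * π * volume.real Ω * X := by
    rw [← e2]
    refine (mul_le_mul_of_nonneg_left hrn (sq_nonneg d)).trans (le_of_eq_of_le ?_ h5)
    ring
  have h7 : X * (d * γ ^ 2) ≤ X * exp (d * γ ^ 2) - 1 := by
    have := mul_le_mul_of_nonneg_left (add_one_le_exp (d * γ ^ 2)) (zero_le_one.trans hX1)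
    linarith
  have h8 : X * (γ ^ 2 * d ^ 3) ≤ X * (32 * π * volume.real Ω) := by
    have := mul_le_mul_of_nonneg_left h7 (sq_nonneg d)
    linarith
  exact absurd (le_of_mul_le_mul_left h8 (zero_lt_one.trans_le hX1)) hγ2.not_ge

/-- On the sphere of radius `r` around the maximum point, `v` lies below `c γ`. -/
theorem eventually_lt_on_sphere (B : IsBlowUp Ω v A L x) {r : ℕ → ℝ} {δ c : ℝ}
    (hr0 : ∀ n, 0 < r n)
    (hr : ∀ᶠ n in atTop, 4 * (exp (δ * v n (x n) ^ 2) - 1) ≤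
      r n ^ 2 * v n (x n) ^ 2 * exp (v n (x n) ^ 2))
    (hδ1 : δ < 1) (hc : 1 - δ < c) (hc1 : c < 1) :
    ∀ᶠ n in atTop, ∀ y ∈ Ω, dist y (x n) = r n → v n y < c * v n (x n) := by
  set κ := (c - (1 - δ)) / 4 with hκ
  have hκ0 : 0 < κ := by rw [hκ]; linarith
  set c₁ := c - 2 * κ with hc₁
  have hη : 0 < κ / 4 := by linarith
  filter_upwards [B.eventually_exists_separating hr0 hr hδ1 (c := c₁ - κ) (by linarith)
      (by linarith), B.eventually_le_levelEnergy_sub (c₀ := c₁) (c₁ := 1) (by linarith) hη,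
    B.eventually_le_levelEnergy_sub (c₀ := c₁) (c₁ := c) (by linarith) hη,
    B.eventually_le_levelEnergy_sub (c₀ := κ / 4) (c₁ := c₁) (by linarith) hη,
    B.eventually_energy_le hη, B.eventually_pos] with n hsep hx hy hΩ hE hγ y hyΩ hyr
  by_contra! hcy
  set γ := v n (x n) with hγdef
  have ha0 : 0 < (c₁ - κ) * γ := mul_pos (by linarith) hγ
  have hac : (c₁ - κ) * γ < c₁ * γ := mul_lt_mul_of_pos_right (by linarith) hγ
  obtain ⟨i, hi⟩ := exists_half_le_abs_sub hyr
  have hmin : r n / 2 ≤ max (y i) (x n i) - min (y i) (x n i) := by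
    rwa [max_sub_min_eq_abs']
  obtain ⟨t, ⟨ht1, ht2⟩, ht⟩ := hsep i _ _ hmin
  have hci : Continuous fun p : E2 => p i := by fun_prop
  have P₁ : IsPiece (Ω ∩ {p | p i < t}) (v n) (mtNonlin (A n) (L n)) ((c₁ - κ) * γ) := by
    refine B.isPiece (B.isOpen.inter (isOpen_lt hci continuous_const)) Set.inter_subset_left ha0
      fun p hp hpc hpD => ht p hp (le_antisymm ?_ ?_)
    · exact closure_minimal (fun q hq => (show q i < t from hq.2).le)
        (isClosed_le hci continuous_const) hpc
    · by_contra h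
      exact hpD ⟨hp, not_le.1 h⟩
  have P₂ : IsPiece (Ω ∩ {p | t < p i}) (v n) (mtNonlin (A n) (L n)) ((c₁ - κ) * γ) := by
    refine B.isPiece (B.isOpen.inter (isOpen_lt continuous_const hci)) Set.inter_subset_left ha0
      fun p hp hpc hpD => ht p hp (le_antisymm ?_ ?_)
    · by_contra h
      exact hpD ⟨hp, not_le.1 h⟩
    · exact closure_minimal (fun q hq => (show t < q i from hq.2).le)
        (isClosed_le continuous_const hci) hpc
  have hsum := (B.isPiece_self n ha0).levelEnergy_eq_add hac.le
    fun p hp hpt => (ht p hp hpt).le.trans hac.le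
  have hx' := fun D hD Q hxD => hx D hD _ ha0 hac Q (x n) hxD (one_mul _).le
  have hy' := fun D hD Q hyD => hy D hD _ ha0 hac Q y hyD hcy
  have hlow : 4 * π * (1 - c₁ - κ / 4) + 4 * π * (c - c₁ - κ / 4) ≤
      levelEnergy Ω (v n) (c₁ * γ) := by
    rw [hsum]
    have n1 := levelEnergy_nonneg (Ω ∩ {p | p i < t}) (v n)
    have n2 := levelEnergy_nonneg (Ω ∩ {p | t < p i}) (v n)
    rcases le_total (x n i) (y i) with hxy | hxy
    · rw [min_eq_right hxy] at ht1
      rw [max_eq_left hxy] at ht2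
      have i1 := hx' _ Set.inter_subset_left P₁ ⟨B.mem n, ht1⟩
      have i2 := hy' _ Set.inter_subset_left P₂ ⟨hyΩ, ht2⟩
      linarith [n1 (1 * γ), n2 (c * γ)]
    · rw [min_eq_left hxy] at ht1
      rw [max_eq_right hxy] at ht2
      have i1 := hx' _ Set.inter_subset_left P₂ ⟨B.mem n, ht2⟩
      have i2 := hy' _ Set.inter_subset_left P₁ ⟨hyΩ, ht1⟩
      linarith [n2 (1 * γ), n1 (c * γ)]
  have hb : 0 < κ / 8 * γ := by positivity
  have P := B.isPiece_self n hb
  have h1 := hΩ Ω subset_rfl _ hb (mul_lt_mul_of_pos_right (by linarith) hγ) P (x n) (B.mem n)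
    (by nlinarith)
  have h2 := B.levelEnergy_le subset_rfl P (κ / 4 * γ)
  have h3 : 4 * π * (1 - c₁ - κ / 4) + 4 * π * (c - c₁ - κ / 4) + 4 * π * (c₁ - κ / 4 - κ / 4) ≤
      4 * π * (1 + κ / 4) := by linarith
  have h4 : (1 - c₁ - κ / 4) + (c - c₁ - κ / 4) + (c₁ - κ / 4 - κ / 4) ≤ 1 + κ / 4 := by
    refine le_of_mul_le_mul_left (a := 4 * π) ?_ (by positivity)
    linarith
  linarith

end IsBlowUp

theorem integral_mul_fderiv_add_eq_zero {u φ : E2 → ℝ} (hu : ContDiff ℝ 1 u)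
    (hc : HasCompactSupport u) (hφ : ContDiff ℝ 1 φ) (e : E2) :
    ∫ y, (u y * fderiv ℝ φ y e + φ y * fderiv ℝ u y e) = 0 := by
  rw [← integral_fderiv_apply_eq_zero (hu.mul hφ) hc.mul_right e]
  refine integral_congr_ae (Eventually.of_forall fun y => ?_)
  have h : HasFDerivAt (fun y => u y * φ y) _ y :=
    (hu.differentiable one_ne_zero y).hasFDerivAt.mul (hφ.differentiable one_ne_zero y).hasFDerivAt
  simp only [h.fderiv]
  simp

/-- Integration by parts for the positive part of `v - a`. -/
theorem IsPiece.integral_sub_mul_fderiv {D : Set E2} {v : E2 → ℝ} {G : ℝ → ℝ} {a : ℝ}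
    (P : IsPiece D v G a) {φ : E2 → ℝ} (hφ : ContDiff ℝ 1 φ) (e : E2) :
    ∫ y in superlevel D v a, ((v y - a) * fderiv ℝ φ y e + φ y * fderiv ℝ v y e) = 0 := by
  have hmeas := (P.isOpen_superlevel a).measurableSet
  have hε : ∀ k : ℕ, (0 : ℝ) < 1 / (k + 1 : ℝ) := fun k => by positivity
  have hdφ : ContinuousOn (fun y => fderiv ℝ φ y e) D :=
    ((hφ.continuous_fderiv one_ne_zero).clm_apply continuous_const).continuousOn
  have hdv : ContinuousOn (fun y => fderiv ℝ v y e) D :=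
    P.continuousOn_fderiv.clm_apply continuousOn_const
  have hφc : ContinuousOn φ D := hφ.continuous.continuousOn
  have hvc := P.smooth.continuousOn
  have hzero : ∀ k : ℕ, ∫ y in superlevel D v a, (ramp a (1 / (k + 1 : ℝ)) (v y) *
      fderiv ℝ φ y e + φ y * (rampDeriv a (1 / (k + 1 : ℝ)) (v y) * fderiv ℝ v y e)) = 0 := by
    intro k
    obtain ⟨hu1, huc⟩ := P.contDiff_indicator (contDiff_ramp a (1 / (k + 1 : ℝ)))
      fun t ht => ramp_of_le (hε k) ht
    have hz : ∀ y ∉ superlevel D v a, (D.indicator fun y => ramp a (1 / (k + 1 : ℝ)) (v y)) y *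
        fderiv ℝ φ y e +
          φ y * fderiv ℝ (D.indicator fun y => ramp a (1 / (k + 1 : ℝ)) (v y)) y e = 0 := by
      intro y hy
      by_cases hD : y ∈ D
      · have hva : v y ≤ a := by by_contra h; exact hy ⟨hD, not_le.1 h⟩
        rw [P.fderiv_indicator hD (hasDerivAt_ramp a _ (v y)), Set.indicator_of_mem hD,
          ramp_of_le (hε k) hva, rampDeriv_of_le (hε k) hva]
        simp
      · have hmin : IsLocalMin (D.indicator fun y => ramp a (1 / (k + 1 : ℝ)) (v y)) y := by
          refine Eventually.of_forall fun z => ?_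
          rw [Set.indicator_of_notMem hD]
          refine Set.indicator_nonneg (fun z _ => ?_) z
          unfold ramp
          have : max (v z - a - 1 / (k + 1 : ℝ)) 0 ≤ max (v z - a) 0 :=
            max_le_max (by linarith [hε k]) le_rfl
          have h2 := pow_le_pow_left₀ (le_max_right _ _) this 2
          exact div_nonneg (by linarith) (by linarith [hε k])
        rw [hmin.fderiv_eq_zero, Set.indicator_of_notMem hD]
        simp
    have key := integral_mul_fderiv_add_eq_zero hu1 huc hφ e
    rw [← setIntegral_eq_integral_of_forall_compl_eq_zero hz] at key
    rw [← key]
    refine setIntegral_congr_fun hmeas fun y hy => ?_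
    rw [P.fderiv_indicator hy.1 (hasDerivAt_ramp a _ (v y)), Set.indicator_of_mem hy.1]
    simp
  refine tendsto_nhds_unique (f := fun k : ℕ => ∫ y in superlevel D v a,
    (ramp a (1 / (k + 1 : ℝ)) (v y) * fderiv ℝ φ y e +
      φ y * (rampDeriv a (1 / (k + 1 : ℝ)) (v y) * fderiv ℝ v y e))) (l := atTop) ?_ ?_
  swap
  · simp only [hzero]
    exact tendsto_const_nhds
  refine tendsto_integral_of_dominated_convergence
    (fun y => (|v y - a| + 1) * |fderiv ℝ φ y e| + |φ y| * |fderiv ℝ v y e|) ?_ ?_ ?_ ?_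
  · intro k
    refine (P.integrableOn_of_continuousOn ?_ le_rfl).aestronglyMeasurable
    exact (((contDiff_ramp _ _).continuous.comp_continuousOn hvc).mul hdφ).add
      (hφc.mul (((continuous_rampDeriv _ _).comp_continuousOn hvc).mul hdv))
  · exact P.integrableOn_of_continuousOn
      ((((hvc.sub continuousOn_const).abs.add continuousOn_const).mul hdφ.abs).add
        (hφc.abs.mul hdv.abs)) le_rfl
  · intro k
    filter_upwards [ae_restrict_mem hmeas] with y hy
    have h3 := abs_ramp_sub_le (s := a) (hε k) (v y)
    rw [max_eq_left (sub_nonneg.2 hy.2.le)] at h3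
    have h4 : (1 : ℝ) / (k + 1 : ℝ) ≤ 1 := by
      rw [div_le_one (by positivity)]
      linarith [(k.cast_nonneg : (0 : ℝ) ≤ k)]
    have h5 := abs_sub_abs_le_abs_sub (ramp a (1 / (k + 1 : ℝ)) (v y)) (v y - a)
    have h6 : |ramp a (1 / (k + 1 : ℝ)) (v y)| ≤ |v y - a| + 1 := by linarith
    refine (norm_add_le _ _).trans ?_
    simp only [norm_mul, Real.norm_eq_abs]
    gcongr
    exact mul_le_of_le_one_left (abs_nonneg _) (abs_rampDeriv_le_one (hε k) _)
  · filter_upwards [ae_restrict_mem hmeas] with y hy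
    have l1 := (tendsto_ramp a (v y)).mul_const (fderiv ℝ φ y e)
    have l2 := ((tendsto_rampDeriv a (v y)).mul_const (fderiv ℝ v y e)).const_mul (φ y)
    rw [max_eq_left (sub_nonneg.2 hy.2.le)] at l1
    rw [if_pos hy.2, one_mul] at l2
    exact l1.add l2

section

variable {Ω : Set E2} {φ : E2 → ℝ}

theorem integrable_mul_of_tsupport_subset (hφt : tsupport φ ⊆ Ω) (hφc : HasCompactSupport φ)
    {f ψ : E2 → ℝ} (hf : ContinuousOn f Ω) (hψ : Continuous ψ)
    (hψs : Function.support ψ ⊆ tsupport φ) : Integrable fun y => f y * ψ y := by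
  have h1 : IntegrableOn (fun y => f y * ψ y) (tsupport φ) :=
    ((hf.mono hφt).mul hψ.continuousOn).integrableOn_compact hφc
  refine (integrableOn_iff_integrable_of_support_subset ?_).1 h1
  exact (Function.support_mul_subset_right f ψ).trans hψs

theorem support_fderiv_apply_subset (φ : E2 → ℝ) (e : E2) :
    Function.support (fun y => fderiv ℝ φ y e) ⊆ tsupport φ := by
  intro y hy
  by_contra h
  refine hy ?_
  simp only [fderiv_of_notMem_tsupport ℝ h]
  simp

/-- Integration by parts against a test function. -/
theorem setIntegral_mul_fderiv_eq_neg (hΩ : IsOpen Ω) {v : E2 → ℝ} (hv : ContDiffOn ℝ 1 v Ω)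
    (hφ : ContDiff ℝ 1 φ) (hφt : tsupport φ ⊆ Ω) (hφc : HasCompactSupport φ) (e : E2) :
    ∫ y in Ω, v y * fderiv ℝ φ y e = -∫ y in Ω, fderiv ℝ v y e * φ y := by
  have hw : ContDiff ℝ 1 fun y => v y * φ y := by
    rw [contDiff_iff_contDiffAt]
    intro y
    by_cases hy : y ∈ tsupport φ
    · exact (hv.contDiffAt (hΩ.mem_nhds (hφt hy))).mul hφ.contDiffAt
    · refine contDiffAt_const (c := (0 : ℝ)).congr_of_eventuallyEq ?_
      filter_upwards [notMem_tsupport_iff_eventuallyEq.1 hy] with z hz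
      rw [hz, Pi.zero_apply, mul_zero]
  have hwc : HasCompactSupport fun y => v y * φ y := hφc.mul_left
  have h0 := integral_fderiv_apply_eq_zero hw hwc e
  have hΩ0 : ∀ y ∉ Ω, fderiv ℝ (fun y => v y * φ y) y e = 0 := by
    intro y hy
    have : y ∉ tsupport fun y => v y * φ y := fun h =>
      hy (hφt (tsupport_mul_subset_right h))
    rw [fderiv_of_notMem_tsupport ℝ this]
    simp
  rw [← setIntegral_eq_integral_of_forall_compl_eq_zero hΩ0] at h0
  have hdφ : Continuous fun y => fderiv ℝ φ y e :=
    (hφ.continuous_fderiv one_ne_zero).clm_apply continuous_const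
  have hdv : ContinuousOn (fun y => fderiv ℝ v y e) Ω :=
    (hv.continuousOn_fderiv_of_isOpen hΩ le_rfl).clm_apply continuousOn_const
  have i1 := (integrable_mul_of_tsupport_subset hφt hφc hv.continuousOn hdφ
    (support_fderiv_apply_subset φ e)).integrableOn (s := Ω)
  have i2 := (integrable_mul_of_tsupport_subset hφt hφc hdv hφ.continuous
    (subset_tsupport φ)).integrableOn (s := Ω)
  rw [eq_neg_iff_add_eq_zero, ← MeasureTheory.integral_add i1 i2, ← h0]
  refine setIntegral_congr_fun hΩ.measurableSet fun y hy => ?_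
  have h : HasFDerivAt (fun y => v y * φ y) _ y :=
    ((hv.contDiffAt (hΩ.mem_nhds hy)).differentiableAt one_ne_zero).hasFDerivAt.mul
      (hφ.differentiable one_ne_zero y).hasFDerivAt
  simp only [h.fderiv]
  simp
  ring

/-- The gradient of the truncation of `v` at level `c` inside the ball. -/
def truncGradient (S : Set E2) (v : E2 → ℝ) : E2 → E2 := Sᶜ.indicator (gradient v)

theorem norm_sq_truncGradient (S : Set E2) (v : E2 → ℝ) (y : E2) :
    ‖truncGradient S v y‖ ^ 2 = Sᶜ.indicator (fun y => ‖gradient v y‖ ^ 2) y := by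
  unfold truncGradient
  by_cases h : y ∈ Sᶜ
  · rw [Set.indicator_of_mem h, Set.indicator_of_mem h]
  · rw [Set.indicator_of_notMem h, Set.indicator_of_notMem h]
    simp

theorem IsPiece.setIntegral_truncate_mul_fderiv {v : E2 → ℝ} {G : ℝ → ℝ} {s : Set E2} {c : ℝ}
    (hΩ : IsOpen Ω) (hv : ContDiffOn ℝ 1 v Ω) (P : IsPiece (Ω ∩ s) v G c)
    (hφ : ContDiff ℝ 1 φ) (hφt : tsupport φ ⊆ Ω) (hφc : HasCompactSupport φ) (e : E2) :
    ∫ y in Ω, truncate s v c y * fderiv ℝ φ y e =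
      -∫ y in Ω, φ y * ⟪truncGradient (superlevel (Ω ∩ s) v c) v y, e⟫ := by
  set S := superlevel (Ω ∩ s) v c with hS
  have hSm : MeasurableSet S := (P.isOpen_superlevel c).measurableSet
  have hSΩ : S ⊆ Ω := fun y hy => hy.1.1
  have hdφ : Continuous fun y => fderiv ℝ φ y e :=
    (hφ.continuous_fderiv one_ne_zero).clm_apply continuous_const
  have hdv : ContinuousOn (fun y => fderiv ℝ v y e) Ω :=
    (hv.continuousOn_fderiv_of_isOpen hΩ le_rfl).clm_apply continuousOn_const
  have i1 := (integrable_mul_of_tsupport_subset hφt hφc hv.continuousOn hdφ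
    (support_fderiv_apply_subset φ e)).integrableOn (s := Ω)
  have i2 := (integrable_mul_of_tsupport_subset hφt hφc hdv hφ.continuous
    (subset_tsupport φ)).integrableOn (s := Ω)
  have i3 : IntegrableOn (fun y => (v y - c) * fderiv ℝ φ y e) S :=
    P.integrableOn_of_continuousOn ((P.smooth.continuousOn.sub continuousOn_const).mul
      hdφ.continuousOn) le_rfl
  have i4 : IntegrableOn (fun y => φ y * fderiv ℝ v y e) S :=
    (i2.mono_set hSΩ).congr_fun (fun y _ => mul_comm _ _) hSm
  have h1 : ∫ y in Ω, truncate s v c y * fderiv ℝ φ y e =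
      (∫ y in Ω, v y * fderiv ℝ φ y e) - ∫ y in S, (v y - c) * fderiv ℝ φ y e := by
    have h2 : ∫ y in Ω, S.indicator (fun y => (v y - c) * fderiv ℝ φ y e) y =
        ∫ y in S, (v y - c) * fderiv ℝ φ y e := by
      rw [setIntegral_indicator hSm, Set.inter_eq_self_of_subset_right hSΩ]
    rw [← h2, ← MeasureTheory.integral_sub i1 (i3.integrable_indicator hSm).integrableOn]
    refine setIntegral_congr_fun hΩ.measurableSet fun y hy => ?_
    simp only [truncate]
    by_cases hys : y ∈ S
    · rw [Set.indicator_of_mem hys, if_pos hys.1.2, min_eq_right hys.2.le]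
      ring
    · rw [Set.indicator_of_notMem hys]
      split_ifs with h
      · have : v y ≤ c := by by_contra h'; exact hys ⟨⟨hy, h⟩, not_le.1 h'⟩
        rw [min_eq_left this, sub_zero]
      · rw [sub_zero]
  have h3 : ∫ y in Ω, φ y * ⟪truncGradient S v y, e⟫ =
      (∫ y in Ω, fderiv ℝ v y e * φ y) - ∫ y in S, φ y * fderiv ℝ v y e := by
    have h2 : ∫ y in Ω, S.indicator (fun y => φ y * fderiv ℝ v y e) y =
        ∫ y in S, φ y * fderiv ℝ v y e := by
      rw [setIntegral_indicator hSm, Set.inter_eq_self_of_subset_right hSΩ]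
    rw [← h2, ← MeasureTheory.integral_sub i2 (i4.integrable_indicator hSm).integrableOn]
    refine setIntegral_congr_fun hΩ.measurableSet fun y hy => ?_
    simp only [truncGradient]
    by_cases hys : y ∈ S
    · rw [Set.indicator_of_mem hys, Set.indicator_of_notMem (by simpa using hys)]
      simp
      ring
    · rw [Set.indicator_of_notMem hys, Set.indicator_of_mem hys, inner_gradient_eq]
      ring
  have h4 := P.integral_sub_mul_fderiv hφ e
  rw [MeasureTheory.integral_add i3 i4] at h4
  rw [h1, h3, setIntegral_mul_fderiv_eq_neg hΩ hv hφ hφt hφc e]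
  linarith

theorem continuousOn_truncate {v : E2 → ℝ} {x : E2} {r c : ℝ} {K : Set E2}
    (hv : ContinuousOn v K) (h : ∀ y ∈ K, dist y x = r → v y ≤ c) :
    ContinuousOn (truncate (ball x r) v c) K := by
  classical
  unfold truncate
  refine ContinuousOn.if (fun y hy => ?_) ?_ ?_
  · have : y ∈ sphere x r := frontier_ball_subset_sphere hy.2
    exact min_eq_left (h y hy.1 this)
  · exact ContinuousOn.inf (hv.mono Set.inter_subset_left) continuousOn_const
  · exact hv.mono Set.inter_subset_left

end

theorem hasCompactSupport_of_tsupport_subset {Ω : Set E2} (hΩ : IsBounded Ω) {φ : E2 → ℝ}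
    (h : tsupport φ ⊆ Ω) : HasCompactSupport φ :=
  Metric.isCompact_of_isClosed_isBounded (isClosed_tsupport φ) (hΩ.subset h)

namespace IsBlowUp

variable {Ω : Set E2} {v : ℕ → E2 → ℝ} {A L : ℕ → ℝ} {x : ℕ → E2}

theorem isPiece_inter_ball (B : IsBlowUp Ω v A L x) {n : ℕ} {p : E2} {r a : ℝ} (ha : 0 < a)
    (h : ∀ y ∈ Ω, dist y p = r → v n y < a) :
    IsPiece (Ω ∩ ball p r) (v n) (mtNonlin (A n) (L n)) a := by
  refine B.isPiece (B.isOpen.inter isOpen_ball) Set.inter_subset_left ha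
    fun y hy hyc hyn => h y hy (le_antisymm ?_ ?_)
  · exact closure_ball_subset_closedBall (closure_mono Set.inter_subset_right hyc)
  · by_contra hlt
    exact hyn ⟨hy, not_le.1 hlt⟩

/-- The truncations are admissible with weak gradient `truncGradient`. -/
theorem truncate_admissible (B : IsBlowUp Ω v A L x) {n : ℕ} {p : E2} {r a : ℝ} (ha : 0 < a)
    (h : ∀ y ∈ Ω, dist y p = r → v n y < a) :
    ContinuousOn (truncate (ball p r) (v n) a) (closure Ω) ∧
    (∀ y ∈ frontier Ω, truncate (ball p r) (v n) a y = 0) ∧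
    IntegrableOn (fun y => ‖truncGradient (superlevel (Ω ∩ ball p r) (v n) a) (v n) y‖ ^ 2) Ω ∧
    (∀ φ : E2 → ℝ, ContDiff ℝ (⊤ : ℕ∞) φ → tsupport φ ⊆ Ω → ∀ i : Fin 2,
      (∫ y in Ω, truncate (ball p r) (v n) a y * fderiv ℝ φ y (EuclideanSpace.single i 1)) =
        -∫ y in Ω, φ y * ⟪truncGradient (superlevel (Ω ∩ ball p r) (v n) a) (v n) y,
          EuclideanSpace.single i 1⟫) := by
  have P := B.isPiece_inter_ball ha h
  refine ⟨continuousOn_truncate (B.continuousOn n) fun y hy hyr => ?_, fun y hy => ?_, ?_,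
    fun φ hφ hφt i => ?_⟩
  · by_cases hyΩ : y ∈ Ω
    · exact (h y hyΩ hyr).le
    · rw [B.boundary n y (by rw [B.isOpen.frontier_eq]; exact ⟨hy, hyΩ⟩)]
      exact ha.le
  · have := B.boundary n y hy
    unfold truncate
    split_ifs
    · rw [this, min_eq_left ha.le]
    · exact this
  · simp only [norm_sq_truncGradient]
    exact (B.integrable n).indicator (P.isOpen_superlevel a).measurableSet.compl
  · exact P.setIntegral_truncate_mul_fderiv B.isOpen ((B.smooth n).of_le (by simp))
      (hφ.of_le (by simp)) hφt (hasCompactSupport_of_tsupport_subset B.isBounded hφt) _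

theorem eventually_integral_truncGradient_le (B : IsBlowUp Ω v A L x) {r : ℕ → ℝ} {c η : ℝ}
    (hr0 : ∀ n, 0 < r n) (hc : 0 < c) (hc1 : c < 1) (hη : 0 < η)
    (h : ∀ᶠ n in atTop, ∀ y ∈ Ω, dist y (x n) = r n → v n y < c * v n (x n)) :
    ∀ᶠ n in atTop, (∫ y in Ω, ‖truncGradient
      (superlevel (Ω ∩ ball (x n) (r n)) (v n) (c * v n (x n))) (v n) y‖ ^ 2) ≤
        4 * π * (c + η) := by
  set κ := min (η / 2) ((1 - c) / 2) with hκ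
  have hκ0 : 0 < κ := lt_min (by linarith) (by linarith)
  have hκ1 : κ ≤ η / 2 := min_le_left _ _
  have hκ2 : κ ≤ (1 - c) / 2 := min_le_right _ _
  filter_upwards [h, B.eventually_energy_sub_le (c₀ := c + κ) (by linarith) hκ0,
    B.eventually_pos] with n hn hE hγ
  have ha : 0 < c * v n (x n) := by positivity
  have hac : c * v n (x n) < (c + κ) * v n (x n) := mul_lt_mul_of_pos_right (by linarith) hγ
  have P := B.isPiece_inter_ball ha hn
  have h1 := hE _ Set.inter_subset_left _ ha hac P ⟨B.mem n, mem_ball_self (hr0 n)⟩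
  have h2 := P.levelEnergy_anti le_rfl hac.le
  have h3 : 4 * π * (c + κ + κ) ≤ 4 * π * (c + η) :=
    mul_le_mul_of_nonneg_left (by linarith) (by positivity)
  have h4 := B.energy_sub_levelEnergy Set.inter_subset_left P (c * v n (x n))
  simp only [norm_sq_truncGradient]
  rw [setIntegral_indicator (P.isOpen_superlevel _).measurableSet.compl, ← Set.sdiff_eq, ← h4]
  linarith

theorem continuousOn_gradient_norm (B : IsBlowUp Ω v A L x) (n : ℕ) :
    ContinuousOn (fun y => ‖gradient (v n) y‖) Ω := by
  simp only [norm_gradient_eq]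
  exact (B.isPiece_self n one_pos).continuousOn_norm_fderiv

theorem integrableOn_gradient_norm (B : IsBlowUp Ω v A L x) (n : ℕ) :
    IntegrableOn (fun y => ‖gradient (v n) y‖) Ω := by
  have h1 : IntegrableOn (fun _ : E2 => (1 : ℝ)) Ω :=
    integrableOn_const B.isBounded.measure_lt_top.ne
  refine (h1.add (B.integrable n)).mono'
    ((B.continuousOn_gradient_norm n).aestronglyMeasurable B.isOpen.measurableSet)
    (Eventually.of_forall fun y => ?_)
  simp only [norm_norm, Pi.add_apply]
  nlinarith [sq_nonneg (‖gradient (v n) y‖ - 1), norm_nonneg (gradient (v n) y)]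

theorem eventually_sq_integral_gradient_le (B : IsBlowUp Ω v A L x) {ε : ℝ} (hε : 0 < ε)
    (hε1 : ε < 1) :
    ∀ᶠ n in atTop, (∫ y in Ω, ‖gradient (v n) y‖) ^ 2 ≤ 32 * π * volume.real Ω * ε := by
  have hexp : Tendsto (fun n => exp (-(ε / 2 * v n (x n) ^ 2))) atTop (𝓝 0) := by
    refine tendsto_exp_neg_atTop_nhds_zero.comp ?_
    exact ((tendsto_pow_atTop two_ne_zero).comp B.max_lim).const_mul_atTop (half_pos hε)
  filter_upwards [B.eventually_levelMeasure_le (half_pos hε) (half_lt_self hε) hε1,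
    B.eventually_energy_sub_le_self hε hε1 hε, B.eventually_energy_le one_pos,
    hexp.eventually (gt_mem_nhds hε), B.eventually_pos] with n hm hE hβ hX hγ
  have P := B.isPiece_self n (show 0 < ε * v n (x n) by positivity)
  set U := superlevel Ω (v n) (ε * v n (x n)) with hU
  have hUm : MeasurableSet U := (P.isOpen_superlevel _).measurableSet
  have hUΩ : U ⊆ Ω := fun _ hy => hy.1
  have hΩf : volume Ω ≠ ⊤ := B.isBounded.measure_lt_top.ne
  have hi := B.integrableOn_gradient_norm n
  have hi2 := B.integrable n
  have e := setIntegral_sdiff hUm hi hUΩ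
  have h1 := sq_setIntegral_le (measure_ne_top_of_subset hUΩ hΩf) (hi.mono_set hUΩ)
    (hi2.mono_set hUΩ)
  have h2 := sq_setIntegral_le (measure_ne_top_of_subset Set.sdiff_subset hΩf)
    (hi.mono_set (Set.sdiff_subset (t := U))) (hi2.mono_set Set.sdiff_subset)
  rw [← B.energy_sub_levelEnergy subset_rfl P] at h2
  have hV0 : 0 ≤ volume.real Ω := measureReal_nonneg
  have hm' : volume.real U ≤ volume.real Ω * ε := by
    refine le_trans hm ?_
    gcongr
  have h3 : volume.real U * ∫ y in U, ‖gradient (v n) y‖ ^ 2 ≤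
      volume.real Ω * ε * (4 * π * (1 + 1)) :=
    mul_le_mul hm' ((B.levelEnergy_le subset_rfl P _).trans hβ) (levelEnergy_nonneg _ _ _)
      (by positivity)
  have h4 : volume.real (Ω \ U) * ((∫ y in Ω, ‖gradient (v n) y‖ ^ 2) -
      levelEnergy Ω (v n) (ε * v n (x n))) ≤ volume.real Ω * (4 * π * (ε + ε)) :=
    mul_le_mul (measureReal_mono Set.sdiff_subset hΩf) hE
      (sub_nonneg.2 (B.levelEnergy_le subset_rfl P _)) hV0
  have e' : ∫ y in Ω, ‖gradient (v n) y‖ =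
      (∫ y in U, ‖gradient (v n) y‖) + ∫ y in Ω \ U, ‖gradient (v n) y‖ := by linarith
  rw [e']
  nlinarith [sq_nonneg ((∫ y in U, ‖gradient (v n) y‖) - ∫ y in Ω \ U, ‖gradient (v n) y‖)]

theorem tendsto_integral_gradient_norm (B : IsBlowUp Ω v A L x) :
    Tendsto (fun n => ∫ y in Ω, ‖gradient (v n) y‖) atTop (𝓝 0) := by
  have hV0 : 0 ≤ volume.real Ω := measureReal_nonneg
  have hsq : Tendsto (fun n => (∫ y in Ω, ‖gradient (v n) y‖) ^ 2) atTop (𝓝 0) := by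
    refine tendsto_order.2 ⟨fun b hb => Eventually.of_forall fun n => hb.trans_le (sq_nonneg _),
      fun b hb => ?_⟩
    set C := 32 * π * volume.real Ω with hC
    have hC0 : 0 ≤ C := by positivity
    set ε := min (1 / 2) (b / (C + 1)) with hε
    have hε0 : 0 < ε := by positivity
    filter_upwards [B.eventually_sq_integral_gradient_le hε0
      ((min_le_left _ _).trans_lt one_half_lt_one)] with n hn
    refine hn.trans_lt ?_
    have h1 : ε * (C + 1) ≤ b := (le_div_iff₀ (by positivity)).1 (min_le_right _ _)
    linarith
  have h := hsq.sqrt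
  rw [sqrt_zero] at h
  exact h.congr fun n => sqrt_sq (integral_nonneg fun _ => norm_nonneg _)

theorem tendsto_integral_inner_gradient (B : IsBlowUp Ω v A L x) {φ : E2 → ℝ}
    (hφ : ContDiff ℝ 1 φ) (hφc : HasCompactSupport φ) :
    Tendsto (fun n => ∫ y in Ω, ⟪gradient (v n) y, gradient φ y⟫) atTop (𝓝 0) := by
  obtain ⟨M, hM⟩ := (hφ.continuous_fderiv one_ne_zero).bounded_above_of_compact_support
    (hφc.fderiv (𝕜 := ℝ))
  have h0 := B.tendsto_integral_gradient_norm.mul_const M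
  rw [zero_mul] at h0
  refine squeeze_zero_norm (fun n => ?_) h0
  rw [← MeasureTheory.integral_mul_const]
  refine norm_integral_le_of_norm_le ((B.integrableOn_gradient_norm n).mul_const M)
    (Eventually.of_forall fun y => ?_)
  refine (norm_inner_le_norm _ _).trans ?_
  rw [norm_gradient_eq φ]
  exact mul_le_mul_of_nonneg_left (hM y) (norm_nonneg _)

theorem levelMass_nonneg (B : IsBlowUp Ω v A L x) (n : ℕ) {s : ℝ} (hs : 0 < s) :
    0 ≤ levelMass Ω (v n) (mtNonlin (A n) (L n)) s :=
  setIntegral_nonneg ((B.isPiece_self n hs).isOpen_superlevel s).measurableSet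
    fun _ hy => B.mtNonlin_nonneg n hs _ hy.2.le

theorem tendsto_levelMass (B : IsBlowUp Ω v A L x) {s : ℝ} (hs : 0 < s) :
    Tendsto (fun n => levelMass Ω (v n) (mtNonlin (A n) (L n)) s) atTop (𝓝 0) := by
  refine tendsto_order.2 ⟨fun b hb => Eventually.of_forall fun n =>
    hb.trans_le (B.levelMass_nonneg n hs), fun b hb => ?_⟩
  set ε := min (1 / 2) (s * b / (32 * π)) with hε
  have hε0 : 0 < ε := by positivity
  have hε1 : ε < 1 := (min_le_left _ _).trans_lt one_half_lt_one
  filter_upwards [B.eventually_energy_sub_le_self hε0 hε1 hε0, B.eventually_pos,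
    B.max_lim.eventually_ge_atTop (s / ε)] with n hE hγ hsγ
  rw [div_le_iff₀ hε0, mul_comm] at hsγ
  have P := B.isPiece_self n (half_pos hs)
  have h1 := P.mul_levelMass_le (B.mtNonlin_nonneg n (half_pos hs)) le_rfl (half_le_self hs.le)
  have h2 := B.levelEnergy_le subset_rfl P (s / 2)
  have h3 := P.levelEnergy_anti (half_le_self hs.le) hsγ
  have h4 : ε * (32 * π) ≤ s * b := (le_div_iff₀ (by positivity)).1 (min_le_right _ _)
  have h5 : 0 < s * b := by positivity
  by_contra! h
  have h6 := mul_le_mul_of_nonneg_left h hs.le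
  linarith

theorem tendsto_levelMeasure (B : IsBlowUp Ω v A L x) {s : ℝ} (hs : 0 < s) :
    Tendsto (fun n => levelMeasure Ω (v n) s) atTop (𝓝 0) := by
  have h0 := (B.tendsto_levelMass (half_pos hs)).mul_const (volume.real Ω / (2 * π * s))
  rw [zero_mul] at h0
  refine squeeze_zero (fun n => measureReal_nonneg) (fun n => ?_) h0
  have h4 : 0 < s / 2 / 2 := by positivity
  have h1 := (B.isPiece_self n h4).levelMeasure_mul_le (B.mtNonlin_nonneg n h4)
    (half_lt_self (half_pos hs)) (half_le_self hs.le)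
  have h2 : levelMass Ω (v n) (mtNonlin (A n) (L n)) (s / 2) *
      (levelMeasure Ω (v n) (s / 2) - levelMeasure Ω (v n) s) ≤
      levelMass Ω (v n) (mtNonlin (A n) (L n)) (s / 2) * volume.real Ω := by
    refine mul_le_mul_of_nonneg_left ?_ (B.levelMass_nonneg n (half_pos hs))
    have h5 : 0 ≤ levelMeasure Ω (v n) s := measureReal_nonneg
    linarith [B.levelMeasure_le n (s / 2)]
  rw [mul_div_assoc', le_div_iff₀ (by positivity)]
  linarith

/-- Exponential tail of the distribution functions, uniform along the sequence. -/
theorem eventually_levelMeasure_le_exp (B : IsBlowUp Ω v A L x) :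
    ∀ᶠ n in atTop, ∀ s, 0 < s → levelMeasure Ω (v n) s ≤ volume.real Ω * exp 1 * exp (-s) := by
  filter_upwards [(B.tendsto_levelMass one_pos).eventually
    (gt_mem_nhds (show (0 : ℝ) < 4 * π by positivity))] with n hn s _
  have hV0 : 0 ≤ volume.real Ω := measureReal_nonneg
  have e : volume.real Ω * exp 1 * exp (-s) = volume.real Ω * exp (-(1 * (s - 1))) := by
    rw [mul_assoc, ← exp_add]
    congr 2
    ring
  rw [e]
  rcases le_total s 1 with h | h
  · refine (B.levelMeasure_le n s).trans (le_mul_of_one_le_right hV0 (one_le_exp ?_))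
    linarith
  · have h2 : (0 : ℝ) < 1 / 2 := by norm_num
    refine ((B.isPiece_self n h2).levelMeasure_le_exp (B.mtNonlin_nonneg n h2)
      (B.mtNonlin_monotoneOn n h2) zero_le_one (by norm_num) h (by linarith)).trans ?_
    gcongr
    exact B.levelMeasure_le n 1

theorem tendsto_integral_rpow (B : IsBlowUp Ω v A L x) {q : ℝ} (hq : 0 < q) :
    Tendsto (fun n => ∫ y in Ω, |v n y| ^ q) atTop (𝓝 0) := by
  have hΩm := B.isOpen.measurableSet
  have hmeas : ∀ n, AEMeasurable (v n) (volume.restrict Ω) := fun n =>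
    (B.smooth n).continuousOn.aemeasurable hΩm
  have hset : ∀ n t, volume.restrict Ω {y | t < v n y} =
      ENNReal.ofReal (levelMeasure Ω (v n) t) := fun n t => by
    have hfin : volume (superlevel Ω (v n) t) ≠ ⊤ :=
      measure_ne_top_of_subset (fun _ hy => hy.1) B.isBounded.measure_lt_top.ne
    rw [Measure.restrict_apply' hΩm, levelMeasure, ofReal_measureReal hfin]
    congr 1
    ext y
    exact and_comm
  have hlin : Tendsto (fun n => ∫⁻ t in Set.Ioi (0 : ℝ),
      volume.restrict Ω {y | t < v n y} * ENNReal.ofReal (t ^ (q - 1))) atTop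
      (𝓝 (∫⁻ _ in Set.Ioi (0 : ℝ), 0)) := by
    refine tendsto_lintegral_filter_of_dominated_convergence
      (fun t => ENNReal.ofReal (volume.real Ω * exp 1 * (exp (-t) * t ^ (q - 1)))) ?_ ?_ ?_ ?_
    · refine Eventually.of_forall fun n => Measurable.mul ?_ (by fun_prop)
      refine Antitone.measurable fun s t hst => measure_mono fun y hy => ?_
      exact lt_of_le_of_lt hst hy
    · filter_upwards [B.eventually_levelMeasure_le_exp] with n hn
      filter_upwards [ae_restrict_mem measurableSet_Ioi] with t ht
      have hm0 : 0 ≤ levelMeasure Ω (v n) t := measureReal_nonneg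
      rw [hset, ← ENNReal.ofReal_mul hm0, ← mul_assoc]
      have ht0 : 0 ≤ t ^ (q - 1) := rpow_nonneg (le_of_lt ht) _
      gcongr
      exact hn t ht
    · exact (Integrable.lintegral_lt_top ((GammaIntegral_convergent hq).const_mul _)).ne
    · filter_upwards [ae_restrict_mem measurableSet_Ioi] with t ht
      simp only [hset]
      have h1 := ENNReal.tendsto_ofReal (B.tendsto_levelMeasure (s := t) ht)
      rw [ENNReal.ofReal_zero] at h1
      have h2 := ENNReal.Tendsto.mul_const (b := ENNReal.ofReal (t ^ (q - 1))) h1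
        (Or.inr ENNReal.ofReal_ne_top)
      rwa [zero_mul] at h2
  rw [lintegral_zero] at hlin
  have h3 := ENNReal.Tendsto.const_mul (a := ENNReal.ofReal q) hlin
    (Or.inr ENNReal.ofReal_ne_top)
  rw [mul_zero] at h3
  have h4 := (ENNReal.tendsto_toReal ENNReal.zero_ne_top).comp h3
  rw [ENNReal.toReal_zero] at h4
  refine h4.congr fun n => ?_
  have hv0 : 0 ≤ᵐ[volume.restrict Ω] v n := by
    filter_upwards [ae_restrict_mem hΩm] with y hy using (B.pos n y hy).le
  rw [Function.comp_apply, ← lintegral_rpow_eq_lintegral_meas_lt_mul _ hv0 (hmeas n) hq,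
    ← integral_eq_lintegral_of_nonneg_ae]
  · refine setIntegral_congr_fun hΩm fun y hy => ?_
    simp only [abs_of_pos (B.pos n y hy)]
  · filter_upwards [hv0] with y hy using rpow_nonneg hy q
  · exact ((hmeas n).pow_const q).aestronglyMeasurable

end IsBlowUp

/-- The truncations `ṽ_α` (equal to `min(v_α, (1−δ')γ_α)` in `B_{x_α}(r_{α,δ})` and to `v_α`
outside) lie in `H¹₀(Ω)` (they are continuous up to `∂Ω`, vanish there, and admit a
square-integrable weak gradient `g_α`), with `∫_Ω |∇ṽ_α|² ≤ 4π(1 − δ' + o(1))`.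
In particular `v_α ⇀ 0` weakly in `H¹₀(Ω)` and `v_α → 0` strongly in `Lᵖ(Ω)` for all `p ≥ 1`. -/
theorem truncation_energy_bound
    (Ω : Set E2) (hΩo : IsOpen Ω) (hΩb : IsBounded Ω) (hΩc : IsConnected Ω)
    (lam1 : ℝ) (hlam1 : 0 < lam1)
    (v : ℕ → E2 → ℝ) (A L : ℕ → ℝ) (x : ℕ → E2)
    (hA : ∀ n, 0 ≤ A n ∧ A n < lam1) (hLpos : ∀ n, 0 < L n)
    (hsm : ∀ n, ContDiffOn ℝ (⊤ : ℕ∞) (v n) Ω)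
    (hct : ∀ n, ContinuousOn (v n) (closure Ω))
    (hpos : ∀ n, ∀ y ∈ Ω, 0 < v n y)
    (hpde : ∀ n, ∀ y ∈ Ω, lapl (v n) y = v n y * (A n + L n * Real.exp ((v n y) ^ 2)))
    (hbd : ∀ n, ∀ y ∈ frontier Ω, v n y = 0)
    (hgint : ∀ n, IntegrableOn (fun y => ‖gradient (v n) y‖ ^ 2) Ω)
    (henergy : Tendsto (fun n => ∫ y in Ω, ‖gradient (v n) y‖ ^ 2) atTop (𝓝 (4 * Real.pi)))
    (hAlim : Tendsto A atTop (𝓝 lam1)) (hLlim : Tendsto L atTop (𝓝 0))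
    (hxΩ : ∀ n, x n ∈ Ω) (hmax : ∀ n, ∀ y ∈ Ω, v n y ≤ v n (x n))
    (hγ : Tendsto (fun n => v n (x n)) atTop atTop)
    (μ : ℕ → ℝ)
    (hμ : ∀ n, 0 < μ n ∧
      ((μ n)⁻¹) ^ 2 = L n / 4 * (v n (x n)) ^ 2 * Real.exp ((v n (x n)) ^ 2))
    (δ : ℝ) (hδ0 : 0 < δ) (hδ1 : δ < 1)
    (r : ℕ → ℝ)
    (hr : ∀ n, 0 < r n ∧ Real.log (1 + (r n) ^ 2 / (μ n) ^ 2) = δ * (v n (x n)) ^ 2)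
    (δ' : ℝ) (hδ'0 : 0 < δ') (hδ'δ : δ' < δ) :
    (∃ g : ℕ → E2 → E2,
      (∀ᶠ n in atTop,
        ContinuousOn (truncate (Metric.ball (x n) (r n)) (v n) ((1 - δ') * v n (x n)))
          (closure Ω) ∧
        (∀ y ∈ frontier Ω,
          truncate (Metric.ball (x n) (r n)) (v n) ((1 - δ') * v n (x n)) y = 0) ∧
        IntegrableOn (fun y => ‖g n y‖ ^ 2) Ω ∧
        (∀ φ : E2 → ℝ, ContDiff ℝ (⊤ : ℕ∞) φ → tsupport φ ⊆ Ω → ∀ i : Fin 2,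
          (∫ y in Ω, truncate (Metric.ball (x n) (r n)) (v n) ((1 - δ') * v n (x n)) y
              * fderiv ℝ φ y (EuclideanSpace.single i 1))
            = -∫ y in Ω, φ y * ⟪g n y, EuclideanSpace.single i 1⟫)) ∧
      (∃ ε : ℕ → ℝ, Tendsto ε atTop (𝓝 0) ∧
        ∀ᶠ n in atTop, (∫ y in Ω, ‖g n y‖ ^ 2) ≤ 4 * Real.pi * (1 - δ' + ε n))) ∧
    (∀ φ : E2 → ℝ, ContDiff ℝ (⊤ : ℕ∞) φ → tsupport φ ⊆ Ω →
      Tendsto (fun n => ∫ y in Ω, ⟪gradient (v n) y, gradient φ y⟫) atTop (𝓝 0)) ∧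
    (∀ q : ℝ, 1 ≤ q → Tendsto (fun n => ∫ y in Ω, |v n y| ^ q) atTop (𝓝 0)) := by
  have B : IsBlowUp Ω v A L x :=
    { isOpen := hΩo, isBounded := hΩb, A_nonneg := fun n => (hA n).1, L_pos := hLpos
      smooth := hsm, continuousOn := hct, pos := hpos, pde := hpde, boundary := hbd
      integrable := hgint, energy := henergy, L_lim := hLlim, mem := hxΩ, le_max := hmax
      max_lim := hγ }
  have hr0 : ∀ n, 0 < r n := fun n => (hr n).1
  have hc0 : 0 < 1 - δ' := by linarith
  have hc1 : 1 - δ' < 1 := by linarith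
  have hsph := B.eventually_lt_on_sphere hr0 (B.eventually_le_radius_sq hμ hr) hδ1
    (c := 1 - δ') (by linarith) hc1
  refine ⟨⟨fun n => truncGradient
    (superlevel (Ω ∩ ball (x n) (r n)) (v n) ((1 - δ') * v n (x n))) (v n), ?_, ?_⟩,
    fun φ hφ hφt => B.tendsto_integral_inner_gradient (hφ.of_le (by simp))
      (hasCompactSupport_of_tsupport_subset hΩb hφt),
    fun q hq => B.tendsto_integral_rpow (zero_lt_one.trans_le hq)⟩
  · filter_upwards [hsph, B.eventually_pos] with n hn hγn
    exact B.truncate_admissible (mul_pos hc0 hγn) hn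
  · refine ⟨fun n => max 0 ((∫ y in Ω, ‖truncGradient
      (superlevel (Ω ∩ ball (x n) (r n)) (v n) ((1 - δ') * v n (x n))) (v n) y‖ ^ 2) /
        (4 * π) - (1 - δ')), ?_, Eventually.of_forall fun n => ?_⟩
    · refine tendsto_order.2 ⟨fun b hb => Eventually.of_forall fun n =>
        hb.trans_le (le_max_left _ _), fun b hb => ?_⟩
      filter_upwards [B.eventually_integral_truncGradient_le hr0 hc0 hc1 (half_pos hb) hsph]
        with n hn
      refine max_lt hb ?_
      have := (div_le_iff₀' (by positivity : 0 < 4 * π)).2 hn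
      linarith
    · rw [← div_le_iff₀' (by positivity)]
      linarith [le_max_right 0 ((∫ y in Ω, ‖truncGradient
        (superlevel (Ω ∩ ball (x n) (r n)) (v n) ((1 - δ') * v n (x n))) (v n) y‖ ^ 2) /
          (4 * π) - (1 - δ'))]
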